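/- arXiv:2105.00747 — 6 statements merged into one kernel-verified Lean document; each statement's English description precedes it below -/
import Mathlib

section
/- Let p, q be integers with 0 ≤ p < q ≤ M and set I′ = (pd, qd). Suppose γ > 0 and N_j/(N d) ≥ γ for every j with p+1 ≤ j ≤ q. Then for every continuously differentiable u : [0,1] → ℝ, ∫_{I′} u(x)² dx ≤ 2( (1/(N γ))·Σ_{i=1}^N u(x_i)² + d²·∫_{I′} u′(x)² dx ). -/
open MeasureTheory Finset
open scoped Classical

/-- `histCount M N x j` is the number `N_j` of observation points among `x 1, …, x N`
that belong to the subinterval `I_j`, where `I_1 = [0, d]` and `I_j = ((j-1)d, jd]`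
for `2 ≤ j ≤ M`, with mesh size `d = 1/M`. -/
noncomputable def histCount (M N : ℕ) (x : Fin N → ℝ) (j : ℕ) : ℕ :=
  (Finset.univ.filter (fun i : Fin N =>
    if j = 1 then x i ∈ Set.Icc (0 : ℝ) ((M : ℝ)⁻¹)
    else x i ∈ Set.Ioc (((j : ℝ) - 1) * (M : ℝ)⁻¹) ((j : ℝ) * (M : ℝ)⁻¹))).card

/-- Cauchy–Schwarz bound for the increment of a continuously differentiable function. -/
theorem sq_sub_le_mul_integral_sq_deriv {u u' : ℝ → ℝ} {s t : ℝ} (hst : s ≤ t)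
    (hderiv : ∀ y ∈ Set.Icc s t, HasDerivWithinAt u (u' y) (Set.Icc s t) y)
    (hcont : ContinuousOn u' (Set.Icc s t)) :
    (u t - u s) ^ 2 ≤ (t - s) * ∫ y in s..t, (u' y) ^ 2 := by
  rcases hst.eq_or_lt with rfl | hlt
  · simp
  have hint : IntervalIntegrable u' volume s t := hcont.intervalIntegrable_of_Icc hst
  have hint2 : IntervalIntegrable (fun y => (u' y) ^ 2) volume s t :=
    (hcont.pow 2).intervalIntegrable_of_Icc hst
  have hftc : ∫ y in s..t, u' y = u t - u s :=
    intervalIntegral.integral_eq_sub_of_hasDerivAt_of_le hst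
      (fun y hy => (hderiv y hy).continuousWithinAt)
      (fun y hy => (hderiv y (Set.Ioo_subset_Icc_self hy)).hasDerivAt
        (Icc_mem_nhds hy.1 hy.2)) hint
  have hpos : 0 < t - s := sub_pos.2 hlt
  set c := (u t - u s) / (t - s) with hc
  have hnonneg : 0 ≤ ∫ y in s..t, (u' y - c) ^ 2 :=
    intervalIntegral.integral_nonneg hst fun y _ => sq_nonneg _
  have hexpand : ∫ y in s..t, (u' y - c) ^ 2 =
      (∫ y in s..t, (u' y) ^ 2) - 2 * c * (u t - u s) + (t - s) * c ^ 2 := by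
    have : (fun y => (u' y - c) ^ 2) = fun y => (u' y) ^ 2 - 2 * c * u' y + c ^ 2 := by
      funext y; ring
    rw [this, intervalIntegral.integral_add (hint2.sub (hint.const_mul _)) (by simp),
      intervalIntegral.integral_sub hint2 (hint.const_mul _),
      intervalIntegral.integral_const_mul, hftc, intervalIntegral.integral_const, smul_eq_mul]
  have hmul : c * (t - s) = u t - u s := div_mul_cancel₀ _ hpos.ne'
  rw [hexpand] at hnonneg
  have := mul_nonneg hpos.le hnonneg
  rw [← hmul] at this ⊢
  linarith

theorem integral_sq_le_of_mem_Icc {u u' : ℝ → ℝ} {a b s : ℝ} (hs : s ∈ Set.Icc a b)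
    (hderiv : ∀ y ∈ Set.Icc a b, HasDerivWithinAt u (u' y) (Set.Icc a b) y)
    (hcont : ContinuousOn u' (Set.Icc a b)) :
    ∫ y in a..b, (u y) ^ 2 ≤
      2 * ((b - a) * (u s) ^ 2 + (b - a) ^ 2 * ∫ y in a..b, (u' y) ^ 2) := by
  have hab : a ≤ b := hs.1.trans hs.2
  have hucont : ContinuousOn u (Set.Icc a b) := fun y hy => (hderiv y hy).continuousWithinAt
  have hint2 : IntervalIntegrable (fun y => (u' y) ^ 2) volume a b :=
    (hcont.pow 2).intervalIntegrable_of_Icc hab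
  have hincr : ∀ r t, a ≤ r → r ≤ t → t ≤ b →
      (u t - u r) ^ 2 ≤ (b - a) * ∫ y in a..b, (u' y) ^ 2 := by
    intro r t har hrt htb
    have hsub : Set.Icc r t ⊆ Set.Icc a b := Set.Icc_subset_Icc har htb
    refine (sq_sub_le_mul_integral_sq_deriv hrt
      (fun y hy => (hderiv y (hsub hy)).mono hsub) (hcont.mono hsub)).trans ?_
    refine mul_le_mul (by linarith) ?_
      (intervalIntegral.integral_nonneg hrt fun y _ => sq_nonneg _) (by linarith)
    exact intervalIntegral.integral_mono_interval har hrt htb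
      (Filter.Eventually.of_forall fun y => sq_nonneg _) hint2
  have hpt : ∀ t ∈ Set.Icc a b,
      (u t) ^ 2 ≤ 2 * (u s) ^ 2 + 2 * ((b - a) * ∫ y in a..b, (u' y) ^ 2) := by
    intro t ht
    have h : (u t - u s) ^ 2 ≤ (b - a) * ∫ y in a..b, (u' y) ^ 2 := by
      rcases le_total s t with hst | hts
      · exact hincr s t hs.1 hst ht.2
      · rw [sub_sq_comm]
        exact hincr t s ht.1 hts hs.2
    nlinarith [sq_nonneg (u t - 2 * u s)]
  refine (intervalIntegral.integral_mono_on hab ((hucont.pow 2).intervalIntegrable_of_Icc hab)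
    intervalIntegrable_const hpt).trans_eq ?_
  rw [intervalIntegral.integral_const, smul_eq_mul]
  ring

/-- Averaged version of `integral_sq_le_of_mem_Icc` over finitely many sample points. -/
theorem integral_sq_le_sum_of_mem_Icc {ι : Type*} {u u' : ℝ → ℝ} {a b κ : ℝ} {x : ι → ℝ}
    {S : Finset ι} (hab : a < b) (hκ : 0 < κ) (hcard : κ * (b - a) ≤ S.card)
    (hx : ∀ i ∈ S, x i ∈ Set.Icc a b)
    (hderiv : ∀ y ∈ Set.Icc a b, HasDerivWithinAt u (u' y) (Set.Icc a b) y)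
    (hcont : ContinuousOn u' (Set.Icc a b)) :
    ∫ y in a..b, (u y) ^ 2 ≤
      2 * (1 / κ * ∑ i ∈ S, (u (x i)) ^ 2 + (b - a) ^ 2 * ∫ y in a..b, (u' y) ^ 2) := by
  have hn : (0 : ℝ) < S.card := (mul_pos hκ (sub_pos.2 hab)).trans_le hcard
  have hsum := Finset.sum_le_sum fun i hi => integral_sq_le_of_mem_Icc (hx i hi) hderiv hcont
  rw [Finset.sum_const, ← Finset.mul_sum, Finset.sum_add_distrib, Finset.sum_const,
    ← Finset.mul_sum, nsmul_eq_mul, nsmul_eq_mul] at hsum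
  have hS : 0 ≤ ∑ i ∈ S, (u (x i)) ^ 2 := Finset.sum_nonneg fun i _ => sq_nonneg _
  have hratio : b - a ≤ S.card * (1 / κ) := by
    rw [mul_one_div, le_div_iff₀ hκ]
    linarith
  refine le_of_mul_le_mul_left (hsum.trans ?_) hn
  linarith [mul_le_mul_of_nonneg_right hratio hS]

/-- If the indicator (histogram) function is bounded below by `γ > 0`
on `I′ = (pd, qd)`, then for every continuously differentiable `u` on `[0,1]`,
`∫_{I′} u² ≤ 2( (1/(Nγ))·Σᵢ u(xᵢ)² + d²·∫_{I′} u′² )`. -/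
theorem stmt2 (M N : ℕ) (hM : 0 < M) (hN : 0 < N)
    (x : Fin N → ℝ) (hx : ∀ i, x i ∈ Set.Icc (0 : ℝ) 1)
    (p q : ℕ) (hpq : p < q) (hqM : q ≤ M)
    (γ : ℝ) (hγ : 0 < γ)
    (hlow : ∀ j : ℕ, p + 1 ≤ j → j ≤ q →
      γ ≤ (histCount M N x j : ℝ) / ((N : ℝ) * (M : ℝ)⁻¹))
    (u u' : ℝ → ℝ)
    (hderiv : ∀ t ∈ Set.Icc (0 : ℝ) 1, HasDerivWithinAt u (u' t) (Set.Icc (0 : ℝ) 1) t)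
    (hcont : ContinuousOn u' (Set.Icc (0 : ℝ) 1)) :
    (∫ t in Set.Ioo ((p : ℝ) * (M : ℝ)⁻¹) ((q : ℝ) * (M : ℝ)⁻¹), (u t) ^ 2) ≤
      2 * ((1 / ((N : ℝ) * γ)) * ∑ i, (u (x i)) ^ 2
        + ((M : ℝ)⁻¹) ^ 2 *
          ∫ t in Set.Ioo ((p : ℝ) * (M : ℝ)⁻¹) ((q : ℝ) * (M : ℝ)⁻¹), (u' t) ^ 2) := by
  have hMpos : (0 : ℝ) < M := Nat.cast_pos.2 hM
  have hNpos : (0 : ℝ) < N := Nat.cast_pos.2 hN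
  set d : ℝ := (M : ℝ)⁻¹ with hd
  have hdpos : 0 < d := inv_pos.2 hMpos
  have hMd : (M : ℝ) * d = 1 := mul_inv_cancel₀ hMpos.ne'
  have hcell : ∀ k < q, Set.Icc ((k : ℝ) * d) (((k + 1 : ℕ) : ℝ) * d) ⊆ Set.Icc 0 1 := by
    intro k hk
    refine Set.Icc_subset_Icc (by positivity) ?_
    rw [← hMd]
    have : ((k + 1 : ℕ) : ℝ) ≤ M := by exact_mod_cast (show k + 1 ≤ M by omega)
    gcongr
  have hucont : ContinuousOn u (Set.Icc 0 1) := fun y hy => (hderiv y hy).continuousWithinAt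
  have hsplit : ∀ f : ℝ → ℝ, ContinuousOn f (Set.Icc 0 1) →
      ∫ t in Set.Ioo ((p : ℝ) * d) ((q : ℝ) * d), f t =
        ∑ k ∈ Finset.Ico p q, ∫ t in ((k : ℝ) * d)..(((k + 1 : ℕ) : ℝ) * d), f t := by
    intro f hf
    have hle : (p : ℝ) * d ≤ (q : ℝ) * d := by gcongr
    rw [← integral_Ioc_eq_integral_Ioo, ← intervalIntegral.integral_of_le hle]
    refine (intervalIntegral.sum_integral_adjacent_intervals_Ico
      (a := fun k : ℕ => (k : ℝ) * d) hpq.le fun k hk => ?_).symm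
    exact (hf.mono (hcell k hk.2)).intervalIntegrable_of_Icc
      (by push_cast; nlinarith)
  rw [hsplit (fun t => (u t) ^ 2) (hucont.pow 2), hsplit (fun t => (u' t) ^ 2) (hcont.pow 2)]
  set S : ℕ → Finset (Fin N) := fun k => Finset.univ.filter fun i : Fin N =>
    if k + 1 = 1 then x i ∈ Set.Icc (0 : ℝ) d
    else x i ∈ Set.Ioc ((((k + 1 : ℕ) : ℝ) - 1) * d) (((k + 1 : ℕ) : ℝ) * d) with hS
  have hmem : ∀ k, ∀ i ∈ S k, x i ∈ Set.Icc ((k : ℝ) * d) (((k + 1 : ℕ) : ℝ) * d) := by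
    intro k i hi
    rw [hS, Finset.mem_filter] at hi
    rcases Nat.eq_zero_or_pos k with rfl | hk
    · simpa using hi.2
    · have h := hi.2
      rw [if_neg (by omega)] at h
      exact ⟨by simpa using h.1.le, h.2⟩
  have hmem_pos : ∀ k, 0 < k → ∀ i ∈ S k, (k : ℝ) * d < x i := by
    intro k hk i hi
    have h := (Finset.mem_filter.1 hi).2
    rw [if_neg (by omega)] at h
    simpa using h.1
  have hlt_disj : ∀ k l, k < l → Disjoint (S k) (S l) := by
    intro k l hkl
    refine Finset.disjoint_left.2 fun i hk hl => ?_
    have hkl' : ((k + 1 : ℕ) : ℝ) * d ≤ (l : ℝ) * d := by gcongr; omega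
    linarith [(hmem k i hk).2, hmem_pos l (by omega) i hl]
  have hdisj : Set.PairwiseDisjoint (↑(Finset.Ico p q)) S := by
    intro k _ l _ hkl
    rcases lt_or_gt_of_ne hkl with h | h
    · exact hlt_disj k l h
    · exact (hlt_disj l k h).symm
  have hsample : ∑ k ∈ Finset.Ico p q, ∑ i ∈ S k, (u (x i)) ^ 2 ≤ ∑ i, (u (x i)) ^ 2 := by
    rw [← Finset.sum_biUnion hdisj]
    exact Finset.sum_le_sum_of_subset_of_nonneg (Finset.subset_univ _)
      fun i _ _ => sq_nonneg _
  have hlocal : ∀ k ∈ Finset.Ico p q,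
      ∫ t in ((k : ℝ) * d)..(((k + 1 : ℕ) : ℝ) * d), (u t) ^ 2 ≤
        2 * (1 / ((N : ℝ) * γ) * ∑ i ∈ S k, (u (x i)) ^ 2 +
          d ^ 2 * ∫ t in ((k : ℝ) * d)..(((k + 1 : ℕ) : ℝ) * d), (u' t) ^ 2) := by
    intro k hk
    obtain ⟨hpk, hkq⟩ := Finset.mem_Ico.1 hk
    have hlen : ((k + 1 : ℕ) : ℝ) * d - (k : ℝ) * d = d := by push_cast; ring
    have hcard : (N : ℝ) * γ * d ≤ (S k).card := by
      have h := hlow (k + 1) (by omega) (by omega)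
      rw [le_div_iff₀ (by positivity)] at h
      calc (N : ℝ) * γ * d = γ * (N * d) := by ring
        _ ≤ (S k).card := h
    have h := integral_sq_le_sum_of_mem_Icc (sub_pos.1 (hlen.symm ▸ hdpos))
      (mul_pos hNpos hγ) (by rwa [hlen]) (hmem k)
      (fun y hy => (hderiv y (hcell k hkq hy)).mono (hcell k hkq))
      (hcont.mono (hcell k hkq))
    rwa [hlen] at h
  refine (Finset.sum_le_sum hlocal).trans ?_
  rw [← Finset.mul_sum, Finset.sum_add_distrib, ← Finset.mul_sum, ← Finset.mul_sum]
  gcongr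
end

section
/- Suppose β > 0 and N_j/(N d) ≤ β for every j with 1 ≤ j ≤ M. Then for every continuously differentiable u : [0,1] → ℝ, (1/N)·Σ_{i=1}^N u(x_i)² ≤ 2β( ∫_0^1 u(x)² dx + d²·∫_0^1 u′(x)² dx ). -/
open MeasureTheory Finset intervalIntegral
open scoped Classical

/-- The Cauchy–Schwarz inequality for an integral against the constant function `1`. -/
theorem sq_integral_le_mul_integral_sq {f : ℝ → ℝ} {a b : ℝ} (hab : a ≤ b)
    (hf : ContinuousOn f (Set.Icc a b)) :
    (∫ t in a..b, f t) ^ 2 ≤ (b - a) * ∫ t in a..b, (f t) ^ 2 := by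
  rcases hab.eq_or_lt with rfl | hlt
  · simp
  have hu : ContinuousOn f (Set.uIcc a b) := by rwa [Set.uIcc_of_le hab]
  have hi : IntervalIntegrable f volume a b := hu.intervalIntegrable
  have hi2 : IntervalIntegrable (fun t => (f t) ^ 2) volume a b :=
    (hu.pow 2).intervalIntegrable
  have hpos : 0 < b - a := sub_pos.2 hlt
  set m := (∫ t in a..b, f t) / (b - a) with hm
  have hK : ∫ t in a..b, f t = m * (b - a) := by rw [hm]; field_simp
  have h0 : 0 ≤ ∫ t in a..b, (f t - m) ^ 2 :=
    integral_nonneg hab fun t _ => sq_nonneg _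
  have h1 : ∫ t in a..b, (f t - m) ^ 2 =
      (∫ t in a..b, (f t) ^ 2) - 2 * m * (∫ t in a..b, f t) + m ^ 2 * (b - a) := by
    have : ∀ t, (f t - m) ^ 2 = (f t) ^ 2 - 2 * m * f t + m ^ 2 := fun t => by ring
    simp_rw [this]
    rw [integral_add (hi2.sub (hi.const_mul _)) intervalIntegrable_const,
      integral_sub hi2 (hi.const_mul _), intervalIntegral.integral_const_mul,
      intervalIntegral.integral_const, smul_eq_mul]
    ring
  rw [h1, hK] at h0
  rw [hK]
  nlinarith

/-- The squared increment of a continuously differentiable function is at most the length of the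
interval times the integral of the squared derivative. -/
theorem sq_sub_le_mul_integral_deriv_sq {u u' : ℝ → ℝ} {a b x y : ℝ}
    (hderiv : ∀ t ∈ Set.Icc a b, HasDerivWithinAt u (u' t) (Set.Icc a b) t)
    (hcont : ContinuousOn u' (Set.Icc a b))
    (hy : y ∈ Set.Icc a b) (hx : x ∈ Set.Icc a b) :
    (u x - u y) ^ 2 ≤ (b - a) * ∫ t in a..b, (u' t) ^ 2 := by
  wlog hyx : y ≤ x generalizing x y
  · rw [sub_sq_comm]
    exact this hx hy (le_of_not_ge hyx)
  have hsub : Set.Icc y x ⊆ Set.Icc a b := Set.Icc_subset_Icc hy.1 hx.2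
  have hab : a ≤ b := hx.1.trans hx.2
  have hint : IntervalIntegrable (fun t => (u' t) ^ 2) volume a b :=
    ContinuousOn.intervalIntegrable (by rw [Set.uIcc_of_le hab]; exact hcont.pow 2)
  have hftc : ∫ t in y..x, u' t = u x - u y := by
    refine integral_eq_sub_of_hasDerivAt_of_le hyx
      (fun t ht => ((hderiv t (hsub ht)).mono hsub).continuousWithinAt) (fun t ht => ?_)
      (ContinuousOn.intervalIntegrable ?_)
    · exact (hderiv t (hsub (Set.Ioo_subset_Icc_self ht))).hasDerivAt
        (Icc_mem_nhds (hy.1.trans_lt ht.1) (ht.2.trans_le hx.2))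
    · rw [Set.uIcc_of_le hyx]; exact hcont.mono hsub
  have hmono : ∫ t in y..x, (u' t) ^ 2 ≤ ∫ t in a..b, (u' t) ^ 2 :=
    integral_mono_interval hy.1 hyx hx.2 (Filter.Eventually.of_forall fun t => sq_nonneg _) hint
  rw [← hftc]
  refine (sq_integral_le_mul_integral_sq hyx (hcont.mono hsub)).trans ?_
  exact mul_le_mul (by linarith [hy.1, hx.2]) hmono
    (integral_nonneg hyx fun t _ => sq_nonneg _) (by linarith)

/-- A one-dimensional Sobolev inequality: the values of a continuously differentiable function on
an interval are controlled by the `L²` norms of the function and of its derivative. -/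
theorem mul_sq_le_integral_sq_add_integral_deriv_sq {u u' : ℝ → ℝ} {a b x : ℝ}
    (hderiv : ∀ t ∈ Set.Icc a b, HasDerivWithinAt u (u' t) (Set.Icc a b) t)
    (hcont : ContinuousOn u' (Set.Icc a b)) (hx : x ∈ Set.Icc a b) :
    (b - a) * (u x) ^ 2 ≤
      2 * ((∫ t in a..b, (u t) ^ 2) + (b - a) ^ 2 * ∫ t in a..b, (u' t) ^ 2) := by
  have hab : a ≤ b := hx.1.trans hx.2
  have hint : IntervalIntegrable (fun t => (u t) ^ 2) volume a b := by
    refine ContinuousOn.intervalIntegrable ?_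
    rw [Set.uIcc_of_le hab]
    exact ContinuousOn.pow (fun t ht => (hderiv t ht).continuousWithinAt) 2
  have hpt : ∀ y ∈ Set.Icc a b, (u x) ^ 2 ≤
      2 * (u y) ^ 2 + 2 * ((b - a) * ∫ t in a..b, (u' t) ^ 2) := fun y hy => by
    nlinarith [sq_sub_le_mul_integral_deriv_sq hderiv hcont hy hx, sq_nonneg (u x - 2 * u y)]
  have h := integral_mono_on hab intervalIntegrable_const
    ((hint.const_mul 2).add intervalIntegrable_const) hpt
  rw [integral_add (hint.const_mul 2) intervalIntegrable_const,
    intervalIntegral.integral_const_mul, intervalIntegral.integral_const,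
    intervalIntegral.integral_const, smul_eq_mul,
    smul_eq_mul] at h
  linarith

/-- Every point of `[0, 1]` belongs to one of the half-open cells of the mesh `1 / M`, where the
first cell is closed. -/
theorem exists_lt_mem_mesh_cell {M : ℕ} (hM : 0 < M) {x : ℝ} (hx : x ∈ Set.Icc (0 : ℝ) 1) :
    ∃ k < M, x ∈ Set.Icc ((k : ℝ) * (M : ℝ)⁻¹) (((k + 1 : ℕ) : ℝ) * (M : ℝ)⁻¹) ∧
      (k ≠ 0 → (k : ℝ) * (M : ℝ)⁻¹ < x) := by
  have hM' : (0 : ℝ) < M := Nat.cast_pos.2 hM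
  rcases hx.1.eq_or_lt with rfl | hpos
  · exact ⟨0, hM, by simp, by simp⟩
  have hceil : 0 < ⌈x * M⌉₊ := Nat.ceil_pos.2 (by positivity)
  have hle : ⌈x * M⌉₊ ≤ M := Nat.ceil_le.2 (by nlinarith [hx.2])
  obtain ⟨k, hk⟩ : ∃ k, ⌈x * M⌉₊ = k + 1 := ⟨_, (Nat.succ_pred_eq_of_pos hceil).symm⟩
  have hlt : (k : ℝ) * (M : ℝ)⁻¹ < x := by
    rw [← div_eq_mul_inv, div_lt_iff₀ hM']
    exact Nat.lt_ceil.1 (by omega)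
  refine ⟨k, by omega, ⟨hlt.le, ?_⟩, fun _ => hlt⟩
  rw [← div_eq_mul_inv, le_div_iff₀ hM', ← hk]
  exact Nat.le_ceil _

/-- If the indicator (histogram) function is bounded above by `β > 0`
on `[0,1]`, then for every continuously differentiable `u` on `[0,1]`,
`(1/N)·Σᵢ u(xᵢ)² ≤ 2β( ∫₀¹ u² + d²·∫₀¹ u′² )`. -/
theorem stmt3 (M N : ℕ) (hM : 0 < M) (hN : 0 < N)
    (x : Fin N → ℝ) (hx : ∀ i, x i ∈ Set.Icc (0 : ℝ) 1)
    (β : ℝ) (hβ : 0 < β)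
    (hup : ∀ j : ℕ, 1 ≤ j → j ≤ M →
      (histCount M N x j : ℝ) / ((N : ℝ) * (M : ℝ)⁻¹) ≤ β)
    (u u' : ℝ → ℝ)
    (hderiv : ∀ t ∈ Set.Icc (0 : ℝ) 1, HasDerivWithinAt u (u' t) (Set.Icc (0 : ℝ) 1) t)
    (hcont : ContinuousOn u' (Set.Icc (0 : ℝ) 1)) :
    (1 / (N : ℝ)) * ∑ i, (u (x i)) ^ 2 ≤
      2 * β * ((∫ t in (0 : ℝ)..1, (u t) ^ 2)
        + ((M : ℝ)⁻¹) ^ 2 * ∫ t in (0 : ℝ)..1, (u' t) ^ 2) := by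
  have hM' : (0 : ℝ) < M := Nat.cast_pos.2 hM
  have hN' : (0 : ℝ) < N := Nat.cast_pos.2 hN
  set d : ℝ := (M : ℝ)⁻¹ with hd
  have hd0 : 0 < d := inv_pos.2 hM'
  have hMd : (M : ℝ) * d = 1 := mul_inv_cancel₀ hM'.ne'
  have hcell : ∀ k < M, Set.Icc ((k : ℝ) * d) (((k + 1 : ℕ) : ℝ) * d) ⊆ Set.Icc 0 1 := by
    intro k hk
    refine Set.Icc_subset_Icc (by positivity) ?_
    rw [← hMd]
    gcongr
    exact hk
  have hle : ∀ k : ℕ, (k : ℝ) * d ≤ ((k + 1 : ℕ) : ℝ) * d := fun k => by gcongr; omega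
  have hlen : ∀ k : ℕ, ((k + 1 : ℕ) : ℝ) * d - (k : ℝ) * d = d := fun k => by push_cast; ring
  choose f hfM hf hf' using fun i => exists_lt_mem_mesh_cell hM (hx i)
  have hcard : ∀ k < M, ((univ.filter fun i => f i = k).card : ℝ) ≤ β * (N * d) := by
    intro k hk
    have h := hup (k + 1) (by omega) (by omega)
    rw [div_le_iff₀ (by positivity)] at h
    refine le_trans (Nat.cast_le.2 (card_le_card ?_)) h
    intro i hi
    simp only [mem_filter, mem_univ, true_and] at hi ⊢
    subst hi
    have hmem := hf i
    have hlt := hf' i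
    split_ifs with h0
    · have h0' : f i = 0 := by omega
      simpa [h0'] using hmem
    · refine ⟨?_, hmem.2⟩
      simpa using hlt (by omega)
  set A : ℕ → ℝ := fun k => ∫ t in ((k : ℝ) * d)..(((k + 1 : ℕ) : ℝ) * d), (u t) ^ 2
  set B : ℕ → ℝ := fun k => ∫ t in ((k : ℝ) * d)..(((k + 1 : ℕ) : ℝ) * d), (u' t) ^ 2
  have hu : ContinuousOn u (Set.Icc 0 1) := fun t ht => (hderiv t ht).continuousWithinAt
  have hsum : ∀ g : ℝ → ℝ, ContinuousOn g (Set.Icc 0 1) →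
      ∑ k ∈ range M, ∫ t in ((k : ℝ) * d)..(((k + 1 : ℕ) : ℝ) * d), g t =
        ∫ t in (0 : ℝ)..1, g t := by
    intro g hg
    rw [sum_integral_adjacent_intervals (a := fun k : ℕ => (k : ℝ) * d), Nat.cast_zero, zero_mul,
      hMd]
    intro k hk
    refine ContinuousOn.intervalIntegrable ?_
    rw [Set.uIcc_of_le (hle k)]
    exact hg.mono (hcell k hk)
  have hpt : ∀ k < M, ∀ i, f i = k → d * (u (x i)) ^ 2 ≤ 2 * (A k + d ^ 2 * B k) := by
    rintro k hk i rfl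
    have h := mul_sq_le_integral_sq_add_integral_deriv_sq
      (fun t ht => (hderiv t (hcell _ hk ht)).mono (hcell _ hk)) (hcont.mono (hcell _ hk)) (hf i)
    rwa [hlen] at h
  have hA : ∀ k, 0 ≤ A k := fun k => integral_nonneg (hle k) fun t _ => sq_nonneg _
  have hB : ∀ k, 0 ≤ B k := fun k => integral_nonneg (hle k) fun t _ => sq_nonneg _
  have hmain : d * ∑ i, (u (x i)) ^ 2 ≤
      β * (N * d) * (2 * ((∑ k ∈ range M, A k) + d ^ 2 * ∑ k ∈ range M, B k)) := by
    rw [← sum_fiberwise_of_maps_to (s := univ) (t := range M) (g := f)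
      (fun i _ => mem_range.2 (hfM i)), mul_sum, mul_sum, ← sum_add_distrib, mul_sum, mul_sum]
    refine sum_le_sum fun k hk => ?_
    rw [mem_range] at hk
    rw [mul_sum]
    refine (sum_le_card_nsmul _ _ _ fun i hi => hpt k hk i (mem_filter.1 hi).2).trans ?_
    rw [nsmul_eq_mul]
    exact mul_le_mul_of_nonneg_right (hcard k hk)
      (by have := hA k; have := hB k; positivity)
  rw [show ∑ k ∈ range M, A k = ∫ t in (0 : ℝ)..1, (u t) ^ 2 from hsum _ (hu.pow 2),
    show ∑ k ∈ range M, B k = ∫ t in (0 : ℝ)..1, (u' t) ^ 2 from hsum _ (hcont.pow 2)] at hmain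
  rw [one_div, inv_mul_le_iff₀ hN']
  refine le_of_mul_le_mul_left (hmain.trans_eq ?_) hd0
  ring
end

section
/- Let f, s, g : [0,1] → ℝ be twice continuously differentiable, let α > 0, β > 0, and suppose: (i) N_j/(N d) ≤ β for every j with 1 ≤ j ≤ M; (ii) ∫_0^1 (s(x)−f(x))² dx ≤ (d⁴/16)·∫_0^1 f″(x)² dx and ∫_0^1 (s′(x)−f′(x))² dx ≤ (d²/2)·∫_0^1 f″(x)² dx; (iii) ∫_0^1 s″(x)² dx ≤ ∫_0^1 f″(x)² dx; (iv) J(g) ≤ J(s), where J(h) = (1/N)·Σ_{i=1}^N (h(x_i) − f(x_i))² + α·∫_0^1 h″(x)² dx. Then (1/N)·Σ_{i=1}^N (g(x_i) − f(x_i))² ≤ (9/8)·β·d⁴·∫_0^1 f″(x)² dx + α·∫_0^1 f″(x)² dx, and ∫_0^1 (g″(x) − f″(x))² dx ≤ (9/4)·β·(d⁴/α)·∫_0^1 f″(x)² dx + 4·∫_0^1 f″(x)² dx. -/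
open MeasureTheory Finset intervalIntegral
open scoped Classical

/-- A one-dimensional Sobolev-type trace inequality on an interval of length `b - a`. -/
theorem length_mul_sq_le_integral {a b y : ℝ} {e e' : ℝ → ℝ}
    (hy : y ∈ Set.Icc a b)
    (he : ∀ t ∈ Set.Icc a b, HasDerivWithinAt e (e' t) (Set.Icc a b) t)
    (hc : ContinuousOn e' (Set.Icc a b)) :
    (b - a) * e y ^ 2 ≤ ∫ t in a..b, (2 * e t ^ 2 + (b - a) ^ 2 * e' t ^ 2) := by
  have hab : a ≤ b := hy.1.trans hy.2
  have hec : ContinuousOn e (Set.Icc a b) := fun t ht => (he t ht).continuousWithinAt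
  set h : ℝ → ℝ := fun t => 2 * e t * e' t with hh
  have hhc : ContinuousOn h (Set.Icc a b) := by fun_prop
  have key : ∀ t ∈ Set.Icc a b, e y ^ 2 ≤ e t ^ 2 + ∫ u in a..b, |h u| := by
    intro t ht
    have hsub : Set.uIcc t y ⊆ Set.Icc a b := Set.uIcc_subset_Icc ht hy
    have hftc : ∫ u in t..y, h u = e y ^ 2 - e t ^ 2 := by
      refine integral_eq_sub_of_hasDeriv_right (f := fun u => e u ^ 2)
        ((hec.pow 2).mono hsub) ?_ (hhc.mono hsub).intervalIntegrable
      intro u hu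
      have hu' : u ∈ Set.Ioo a b :=
        ⟨(le_min ht.1 hy.1).trans_lt hu.1, hu.2.trans_le (max_le ht.2 hy.2)⟩
      have hd := (he u ⟨hu'.1.le, hu'.2.le⟩).hasDerivAt (Icc_mem_nhds hu'.1 hu'.2)
      simpa [hh, Pi.pow_def] using (hd.pow 2).hasDerivWithinAt
    have hbound : |∫ u in t..y, h u| ≤ ∫ u in a..b, |h u| := by
      refine (norm_integral_le_integral_norm_uIoc (f := h)).trans ?_
      rw [integral_of_le hab]
      refine setIntegral_mono_set
        ((hhc.norm.integrableOn_Icc).mono_set Set.Ioc_subset_Icc_self)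
        (Filter.Eventually.of_forall fun _ => norm_nonneg _) ?_
      exact (Set.Ioc_subset_Ioc (le_min ht.1 hy.1) (max_le ht.2 hy.2)).eventuallyLE
    have := (le_abs_self _).trans hbound
    linarith
  have hI : ∀ {φ : ℝ → ℝ}, ContinuousOn φ (Set.Icc a b) → IntervalIntegrable φ volume a b :=
    fun hφ => ContinuousOn.intervalIntegrable (by rwa [Set.uIcc_of_le hab])
  have h1 : ∫ _t in a..b, e y ^ 2 ≤ ∫ t in a..b, (e t ^ 2 + ∫ u in a..b, |h u|) :=
    integral_mono_on hab (hI continuousOn_const) (hI (by fun_prop)) key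
  have h2 : (b - a) * ∫ u in a..b, |h u| ≤ ∫ t in a..b, (e t ^ 2 + (b - a) ^ 2 * e' t ^ 2) := by
    rw [← intervalIntegral.integral_const_mul]
    refine integral_mono_on hab (hI (by fun_prop)) (hI (by fun_prop)) fun t _ => ?_
    have : (b - a) * |h t| = 2 * |e t| * ((b - a) * |e' t|) := by
      simp only [hh, abs_mul, abs_two]; ring
    rw [this]
    nlinarith [sq_nonneg (|e t| - (b - a) * |e' t|), sq_abs (e t), sq_abs (e' t)]
  rw [integral_add (hI (by fun_prop)) (hI continuousOn_const)] at h1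
  rw [integral_add (hI (by fun_prop)) (hI (by fun_prop))] at h2
  rw [integral_add (hI (by fun_prop)) (hI (by fun_prop)), intervalIntegral.integral_const_mul]
  simp only [intervalIntegral.integral_const, smul_eq_mul] at h1
  linarith

/-- The membership condition defining the cells counted by `histCount` covers `[0, 1]`. -/
theorem exists_cell {M : ℕ} (hM : 0 < M) {y : ℝ} (hy : y ∈ Set.Icc (0 : ℝ) 1) :
    ∃ k ∈ range M, if k + 1 = 1 then y ∈ Set.Icc (0 : ℝ) ((M : ℝ)⁻¹)
      else y ∈ Set.Ioc ((((k + 1 : ℕ) : ℝ) - 1) * (M : ℝ)⁻¹) (((k + 1 : ℕ) : ℝ) * (M : ℝ)⁻¹) := by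
  have hM' : (0 : ℝ) < M := by exact_mod_cast hM
  rcases hy.1.eq_or_lt with h0 | h0
  · refine ⟨0, by simpa using hM, ?_⟩
    simp [← h0]
  · have hyM : 0 < y * M := mul_pos h0 hM'
    have hpos : 0 < ⌈y * M⌉₊ := Nat.ceil_pos.2 hyM
    obtain ⟨k, hk⟩ := Nat.exists_eq_succ_of_ne_zero hpos.ne'
    have hle : ⌈y * M⌉₊ ≤ M := Nat.ceil_le.2 (by nlinarith [hy.2])
    have hupper : y * M ≤ ((k + 1 : ℕ) : ℝ) := by
      have := Nat.le_ceil (y * M)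
      rwa [hk] at this
    have hlower : (k : ℝ) < y * M := Nat.lt_ceil.1 (by omega)
    have hu : y ≤ ((k + 1 : ℕ) : ℝ) * (M : ℝ)⁻¹ := by
      rwa [← div_eq_mul_inv, le_div_iff₀ hM']
    refine ⟨k, by simp; omega, ?_⟩
    split_ifs with hk1
    · obtain rfl : k = 0 := by omega
      exact ⟨hy.1, by simpa using hu⟩
    · refine ⟨?_, hu⟩
      rw [← div_eq_mul_inv, div_lt_iff₀ hM']
      simpa using hlower

/-- If every cell of the uniform partition carries at most a `β`-fold share of the sample, then
the empirical second moment of `e` is controlled by `‖e‖²` and `‖e'‖²` in `L²(0, 1)`. -/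
theorem mean_sq_le_integral {M N : ℕ} (hM : 0 < M) (hN : 0 < N) {x : Fin N → ℝ}
    (hx : ∀ i, x i ∈ Set.Icc (0 : ℝ) 1) {β : ℝ} {e e' : ℝ → ℝ}
    (he : ∀ t ∈ Set.Icc (0 : ℝ) 1, HasDerivWithinAt e (e' t) (Set.Icc (0 : ℝ) 1) t)
    (hc : ContinuousOn e' (Set.Icc (0 : ℝ) 1))
    (hup : ∀ j : ℕ, 1 ≤ j → j ≤ M →
      (histCount M N x j : ℝ) / ((N : ℝ) * (M : ℝ)⁻¹) ≤ β) :
    (1 / (N : ℝ)) * (∑ i, e (x i) ^ 2) ≤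
      β * (2 * (∫ t in (0 : ℝ)..1, e t ^ 2)
        + (M : ℝ)⁻¹ ^ 2 * ∫ t in (0 : ℝ)..1, e' t ^ 2) := by
  have hM' : (0 : ℝ) < M := by exact_mod_cast hM
  have hN' : (0 : ℝ) < N := by exact_mod_cast hN
  set d : ℝ := (M : ℝ)⁻¹ with hd
  have hd0 : 0 < d := inv_pos.2 hM'
  have hMd : (M : ℝ) * d = 1 := mul_inv_cancel₀ hM'.ne'
  have hec : ContinuousOn e (Set.Icc (0 : ℝ) 1) := fun t ht => (he t ht).continuousWithinAt
  have hI : ∀ {φ : ℝ → ℝ}, ContinuousOn φ (Set.Icc (0 : ℝ) 1) →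
      IntervalIntegrable φ volume 0 1 :=
    fun hφ => ContinuousOn.intervalIntegrable (by rwa [Set.uIcc_of_le zero_le_one])
  set G : ℝ → ℝ := fun t => 2 * e t ^ 2 + d ^ 2 * e' t ^ 2 with hG
  have hGc : ContinuousOn G (Set.Icc (0 : ℝ) 1) := by fun_prop
  have hGint : ∫ t in (0 : ℝ)..1, G t =
      2 * (∫ t in (0 : ℝ)..1, e t ^ 2) + d ^ 2 * ∫ t in (0 : ℝ)..1, e' t ^ 2 := by
    rw [hG, integral_add (hI (by fun_prop)) (hI (by fun_prop)), intervalIntegral.integral_const_mul,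
      intervalIntegral.integral_const_mul]
  set p : ℕ → ℝ := fun k => (k : ℝ) * d with hp
  have hple : ∀ k, p k ≤ p (k + 1) := fun k => by
    simp only [hp]; push_cast; nlinarith
  have hcell : ∀ k < M, Set.Icc (p k) (p (k + 1)) ⊆ Set.Icc 0 1 := by
    intro k hk
    refine Set.Icc_subset_Icc (by positivity) ?_
    rw [← hMd]
    exact mul_le_mul_of_nonneg_right (by exact_mod_cast hk) hd0.le
  have hsum : ∑ k ∈ range M, ∫ t in p k..p (k + 1), G t = ∫ t in (0 : ℝ)..1, G t := by
    rw [sum_integral_adjacent_intervals]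
    · simp [hp, hMd]
    · intro k hk
      refine ContinuousOn.intervalIntegrable ?_
      rw [Set.uIcc_of_le (hple k)]
      exact hGc.mono (hcell k hk)
  let P : ℕ → Fin N → Prop := fun j i =>
    if j = 1 then x i ∈ Set.Icc (0 : ℝ) d
    else x i ∈ Set.Ioc (((j : ℝ) - 1) * d) ((j : ℝ) * d)
  have hPmem : ∀ k i, P (k + 1) i → x i ∈ Set.Icc (p k) (p (k + 1)) := by
    intro k i hki
    simp only [P] at hki
    split_ifs at hki with h1
    · obtain rfl : k = 0 := by omega
      simpa [hp] using hki
    · have := Set.Ioc_subset_Icc_self hki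
      simpa [hp] using this
  have hfiber : ∀ k ∈ range M, ∑ i with P (k + 1) i, e (x i) ^ 2 ≤
      β * N * ∫ t in p k..p (k + 1), G t := by
    intro k hk
    have hkM : k < M := mem_range.1 hk
    have hlen : p (k + 1) - p k = d := by simp only [hp]; push_cast; ring
    set C := ∫ t in p k..p (k + 1), G t with hC
    have hC0 : 0 ≤ C := integral_nonneg (hple k) fun t _ => by positivity
    have hpt : ∀ i ∈ univ.filter (P (k + 1)), e (x i) ^ 2 ≤ C / d := by
      intro i hi
      have := length_mul_sq_le_integral (hPmem k i (mem_filter.1 hi).2)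
        (fun t ht => (he t (hcell k hkM ht)).mono (hcell k hkM)) (hc.mono (hcell k hkM))
      rw [hlen] at this
      rw [le_div_iff₀ hd0]
      linarith
    have hcard : ((univ.filter (P (k + 1))).card : ℝ) ≤ β * (N * d) := by
      have := hup (k + 1) (by omega) (by omega)
      rw [div_le_iff₀ (by positivity)] at this
      exact this
    calc ∑ i with P (k + 1) i, e (x i) ^ 2
        ≤ (univ.filter (P (k + 1))).card * (C / d) := by
          simpa using sum_le_card_nsmul _ _ _ hpt
      _ ≤ β * (N * d) * (C / d) := by gcongr
      _ = β * N * C := by field_simp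
  have htotal : ∑ i, e (x i) ^ 2 ≤ ∑ k ∈ range M, ∑ i with P (k + 1) i, e (x i) ^ 2 := by
    simp only [sum_filter]
    rw [sum_comm]
    refine sum_le_sum fun i _ => ?_
    obtain ⟨k, hk, hki⟩ := exists_cell hM (hx i)
    have := single_le_sum (f := fun k => if P (k + 1) i then e (x i) ^ 2 else 0)
      (fun _ _ => by positivity) hk
    have hki' : P (k + 1) i := hki
    simpa only [if_pos hki'] using this
  have hfinal := htotal.trans (sum_le_sum hfiber)
  rw [← mul_sum, hsum, hGint] at hfinal
  rw [one_div, inv_mul_le_iff₀ hN']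
  linarith

/-- Estimates for the noiseless part of the Tikhonov minimizer:
if (i) the histogram is bounded above by `β`; (ii) `s` satisfies the cubic-spline
interpolation-error bounds; (iii) `∫ s″² ≤ ∫ f″²`; and (iv) `J(g) ≤ J(s)` for the
exact-data Tikhonov functional `J`, then the mean squared value of `g − f` at the
observation points and `∫ (g″−f″)²` satisfy the stated bounds. -/
theorem stmt6 (M N : ℕ) (hM : 0 < M) (hN : 0 < N)
    (x : Fin N → ℝ) (hx : ∀ i, x i ∈ Set.Icc (0 : ℝ) 1)
    (α β : ℝ) (hα : 0 < α) (hβ : 0 < β)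
    (f f' f'' s s' s'' g g' g'' : ℝ → ℝ)
    (hf : ∀ t ∈ Set.Icc (0 : ℝ) 1, HasDerivWithinAt f (f' t) (Set.Icc (0 : ℝ) 1) t)
    (hf' : ∀ t ∈ Set.Icc (0 : ℝ) 1, HasDerivWithinAt f' (f'' t) (Set.Icc (0 : ℝ) 1) t)
    (hf'' : ContinuousOn f'' (Set.Icc (0 : ℝ) 1))
    (hs : ∀ t ∈ Set.Icc (0 : ℝ) 1, HasDerivWithinAt s (s' t) (Set.Icc (0 : ℝ) 1) t)
    (hs' : ∀ t ∈ Set.Icc (0 : ℝ) 1, HasDerivWithinAt s' (s'' t) (Set.Icc (0 : ℝ) 1) t)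
    (hs'' : ContinuousOn s'' (Set.Icc (0 : ℝ) 1))
    (hg : ∀ t ∈ Set.Icc (0 : ℝ) 1, HasDerivWithinAt g (g' t) (Set.Icc (0 : ℝ) 1) t)
    (hg' : ∀ t ∈ Set.Icc (0 : ℝ) 1, HasDerivWithinAt g' (g'' t) (Set.Icc (0 : ℝ) 1) t)
    (hg'' : ContinuousOn g'' (Set.Icc (0 : ℝ) 1))
    -- (i) the histogram is bounded above by β
    (hup : ∀ j : ℕ, 1 ≤ j → j ≤ M →
      (histCount M N x j : ℝ) / ((N : ℝ) * (M : ℝ)⁻¹) ≤ β)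
    -- (ii) interpolation-error estimates for s
    (hii₁ : (∫ t in (0 : ℝ)..1, (s t - f t) ^ 2) ≤
      (((M : ℝ)⁻¹) ^ 4 / 16) * ∫ t in (0 : ℝ)..1, (f'' t) ^ 2)
    (hii₂ : (∫ t in (0 : ℝ)..1, (s' t - f' t) ^ 2) ≤
      (((M : ℝ)⁻¹) ^ 2 / 2) * ∫ t in (0 : ℝ)..1, (f'' t) ^ 2)
    -- (iii) Pythagorean-type bound
    (hiii : (∫ t in (0 : ℝ)..1, (s'' t) ^ 2) ≤ ∫ t in (0 : ℝ)..1, (f'' t) ^ 2)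
    -- (iv) J(g) ≤ J(s)
    (hiv : (1 / (N : ℝ)) * (∑ i, (g (x i) - f (x i)) ^ 2)
        + α * (∫ t in (0 : ℝ)..1, (g'' t) ^ 2) ≤
      (1 / (N : ℝ)) * (∑ i, (s (x i) - f (x i)) ^ 2)
        + α * ∫ t in (0 : ℝ)..1, (s'' t) ^ 2) :
    (1 / (N : ℝ)) * (∑ i, (g (x i) - f (x i)) ^ 2) ≤
        (9 / 8) * β * ((M : ℝ)⁻¹) ^ 4 * (∫ t in (0 : ℝ)..1, (f'' t) ^ 2)
          + α * (∫ t in (0 : ℝ)..1, (f'' t) ^ 2) ∧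
    (∫ t in (0 : ℝ)..1, (g'' t - f'' t) ^ 2) ≤
        (9 / 4) * β * (((M : ℝ)⁻¹) ^ 4 / α) * (∫ t in (0 : ℝ)..1, (f'' t) ^ 2)
          + 4 * ∫ t in (0 : ℝ)..1, (f'' t) ^ 2 := by
  have hfc' : ContinuousOn f' (Set.Icc (0 : ℝ) 1) := fun t ht => (hf' t ht).continuousWithinAt
  have hsc' : ContinuousOn s' (Set.Icc (0 : ℝ) 1) := fun t ht => (hs' t ht).continuousWithinAt
  have hI : ∀ {φ : ℝ → ℝ}, ContinuousOn φ (Set.Icc (0 : ℝ) 1) →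
      IntervalIntegrable φ volume 0 1 :=
    fun hφ => ContinuousOn.intervalIntegrable (by rwa [Set.uIcc_of_le zero_le_one])
  have hmean := mean_sq_le_integral hM hN hx (e := fun t => s t - f t)
    (e' := fun t => s' t - f' t) (fun t ht => (hs t ht).sub (hf t ht)) (hsc'.sub hfc') hup
  set F := ∫ t in (0 : ℝ)..1, f'' t ^ 2 with hF
  set d : ℝ := (M : ℝ)⁻¹ with hd
  have hF0 : 0 ≤ F := integral_nonneg zero_le_one fun t _ => sq_nonneg _
  have hG0 : 0 ≤ ∫ t in (0 : ℝ)..1, g'' t ^ 2 :=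
    integral_nonneg zero_le_one fun t _ => sq_nonneg _
  have hS : (1 / (N : ℝ)) * (∑ i, (s (x i) - f (x i)) ^ 2) ≤ (9 / 8) * β * d ^ 4 * F := by
    refine hmean.trans ?_
    calc β * (2 * (∫ t in (0 : ℝ)..1, (s t - f t) ^ 2)
          + d ^ 2 * ∫ t in (0 : ℝ)..1, (s' t - f' t) ^ 2)
        ≤ β * (2 * (d ^ 4 / 16 * F) + d ^ 2 * (d ^ 2 / 2 * F)) := by gcongr
      _ = (5 / 8) * (β * d ^ 4 * F) := by ring
      _ ≤ (9 / 8) * (β * d ^ 4 * F) := by gcongr; norm_num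
      _ = (9 / 8) * β * d ^ 4 * F := by ring
  have hαs := mul_le_mul_of_nonneg_left hiii hα.le
  have hmean0 : 0 ≤ (1 / (N : ℝ)) * (∑ i, (g (x i) - f (x i)) ^ 2) := by positivity
  refine ⟨by linarith [mul_nonneg hα.le hG0], ?_⟩
  have hG : ∫ t in (0 : ℝ)..1, g'' t ^ 2 ≤ (9 / 8) * β * (d ^ 4 / α) * F + F := by
    refine le_of_mul_le_mul_left ?_ hα
    have : α * ((9 / 8) * β * (d ^ 4 / α) * F + F) = (9 / 8) * β * d ^ 4 * F + α * F := by
      field_simp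
    linarith
  have hdiff : ∫ t in (0 : ℝ)..1, (g'' t - f'' t) ^ 2 ≤
      ∫ t in (0 : ℝ)..1, (2 * g'' t ^ 2 + 2 * f'' t ^ 2) :=
    integral_mono_on zero_le_one (hI (by fun_prop)) (hI (by fun_prop))
      fun t _ => by nlinarith [sq_nonneg (g'' t + f'' t)]
  rw [integral_add (hI (by fun_prop)) (hI (by fun_prop)), intervalIntegral.integral_const_mul,
    intervalIntegral.integral_const_mul] at hdiff
  linarith
end

section
/- Under the hypotheses (i)–(iv) of the noiseless-part lemma, if in addition σ > 0 and the regularization parameter is chosen as α = Mσ²/N + d⁴, then (1/N)·Σ_{i=1}^N (g(x_i) − f(x_i))² ≤ (Mσ²/N)·∫_0^1 f″(x)² dx + d⁴·((9/8)β + 1)·∫_0^1 f″(x)² dx, and ∫_0^1 (g″(x) − f″(x))² dx ≤ ((9/4)β + 4)·∫_0^1 f″(x)² dx. -/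
open MeasureTheory Finset intervalIntegral
open scoped Classical

/-- If `|F'| ≤ w` on `[a, b]`, then `F` oscillates on `[a, b]` by at most `∫ w`. -/
lemma abs_sub_le_integral_of_abs_deriv_le {a b : ℝ} {F F' w : ℝ → ℝ}
    (hF : ∀ t ∈ Set.Icc a b, HasDerivWithinAt F (F' t) (Set.Icc a b) t)
    (hF' : ContinuousOn F' (Set.Icc a b)) (hw : ContinuousOn w (Set.Icc a b))
    (hle : ∀ t ∈ Set.Icc a b, |F' t| ≤ w t) {x y : ℝ}
    (hx : x ∈ Set.Icc a b) (hy : y ∈ Set.Icc a b) :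
    |F x - F y| ≤ ∫ t in a..b, w t := by
  wlog hxy : y ≤ x generalizing x y
  · rw [abs_sub_comm]
    exact this hy hx (le_of_not_ge hxy)
  have hab : a ≤ b := hx.1.trans hx.2
  have hsub : Set.Icc y x ⊆ Set.Icc a b := Set.Icc_subset_Icc hy.1 hx.2
  have hint : IntervalIntegrable F' volume y x :=
    (hF'.mono hsub).intervalIntegrable_of_Icc hxy
  have hftc : ∫ t in y..x, F' t = F x - F y := by
    refine integral_eq_sub_of_hasDerivAt_of_le hxy
      (fun t ht => ((hF t (hsub ht)).continuousWithinAt).mono hsub) (fun t ht => ?_) hint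
    exact (hF t (hsub (Set.Ioo_subset_Icc_self ht))).hasDerivAt
      (Icc_mem_nhds (hy.1.trans_lt ht.1) (ht.2.trans_le hx.2))
  rw [← hftc]
  calc |∫ t in y..x, F' t| ≤ ∫ t in y..x, |F' t| := abs_integral_le_integral_abs hxy
    _ ≤ ∫ t in y..x, w t :=
        integral_mono_on hxy hint.abs ((hw.mono hsub).intervalIntegrable_of_Icc hxy)
          fun t ht => hle t (hsub ht)
    _ ≤ ∫ t in a..b, w t := by
        refine integral_mono_interval hy.1 hxy hx.2 ?_ (hw.intervalIntegrable_of_Icc hab)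
        filter_upwards [ae_restrict_mem measurableSet_Ioc] with t ht
        exact (abs_nonneg _).trans (hle t (Set.Ioc_subset_Icc_self ht))

/-- A one-dimensional Sobolev inequality on `[a, b]`. -/
lemma mul_sq_le_integral_sq_add_deriv_sq {a b : ℝ} (hab : a < b) {h h' : ℝ → ℝ}
    (hh : ∀ t ∈ Set.Icc a b, HasDerivWithinAt h (h' t) (Set.Icc a b) t)
    (hh' : ContinuousOn h' (Set.Icc a b)) {x : ℝ} (hx : x ∈ Set.Icc a b) :
    (b - a) * h x ^ 2 ≤ ∫ t in a..b, (2 * h t ^ 2 + (b - a) ^ 2 * h' t ^ 2) := by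
  have hd : 0 < b - a := sub_pos.2 hab
  have hc : ContinuousOn h (Set.Icc a b) := fun t ht => (hh t ht).continuousWithinAt
  set w : ℝ → ℝ := fun t => (b - a)⁻¹ * (h t ^ 2 + (b - a) ^ 2 * h' t ^ 2) with hw_def
  have hwc : ContinuousOn w (Set.Icc a b) := by fun_prop
  have hosc : ∀ y ∈ Set.Icc a b, h x ^ 2 ≤ h y ^ 2 + ∫ t in a..b, w t := by
    intro y hy
    have := abs_sub_le_integral_of_abs_deriv_le (F := fun t => h t ^ 2)
      (F' := fun t => 2 * h t * h' t) (w := w)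
      (fun t ht => by simpa using (hh t ht).fun_pow 2) (by fun_prop) hwc
      (fun t _ => ?_) hx hy
    · linarith [le_abs_self (h x ^ 2 - h y ^ 2)]
    · change |2 * h t * h' t| ≤ (b - a)⁻¹ * (h t ^ 2 + (b - a) ^ 2 * h' t ^ 2)
      rw [inv_mul_eq_div, le_div_iff₀ hd, ← abs_of_pos hd, ← abs_mul, abs_of_pos hd]
      exact abs_le.2 ⟨by nlinarith [sq_nonneg (h t + (b - a) * h' t)],
        by nlinarith [sq_nonneg (h t - (b - a) * h' t)]⟩
  have hi : IntervalIntegrable (fun t => h t ^ 2) volume a b :=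
    (hc.pow 2).intervalIntegrable_of_Icc hab.le
  have hi' : IntervalIntegrable (fun t => h' t ^ 2) volume a b :=
    (hh'.pow 2).intervalIntegrable_of_Icc hab.le
  have hmono := integral_mono_on hab.le (intervalIntegrable_const (μ := volume))
    (hi.add (intervalIntegrable_const (c := ∫ t in a..b, w t))) hosc
  have hwi : ∫ t in a..b, w t = (b - a)⁻¹ *
      ((∫ t in a..b, h t ^ 2) + (b - a) ^ 2 * ∫ t in a..b, h' t ^ 2) := by
    rw [hw_def, intervalIntegral.integral_const_mul,
      intervalIntegral.integral_add hi (hi'.const_mul _), intervalIntegral.integral_const_mul]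
  rw [intervalIntegral.integral_const,
    intervalIntegral.integral_add hi intervalIntegrable_const,
    intervalIntegral.integral_const, hwi, smul_eq_mul, smul_eq_mul,
    mul_inv_cancel_left₀ hd.ne'] at hmono
  rw [intervalIntegral.integral_add (hi.const_mul _) (hi'.const_mul _),
    intervalIntegral.integral_const_mul, intervalIntegral.integral_const_mul]
  linarith

/-- Every point of `[0, 1]` lies in one of the subintervals counted by `histCount`. -/
lemma exists_subinterval_mem {M : ℕ} (hM : 0 < M) {x : ℝ} (hx : x ∈ Set.Icc (0 : ℝ) 1) :
    ∃ k ∈ range M, if k + 1 = 1 then x ∈ Set.Icc (0 : ℝ) ((M : ℝ)⁻¹)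
      else x ∈ Set.Ioc ((((k + 1 : ℕ) : ℝ) - 1) * (M : ℝ)⁻¹)
        (((k + 1 : ℕ) : ℝ) * (M : ℝ)⁻¹) := by
  have hM' : (0 : ℝ) < M := Nat.cast_pos.2 hM
  by_cases h : x ≤ (M : ℝ)⁻¹
  · exact ⟨0, mem_range.2 hM, by simpa using ⟨hx.1, h⟩⟩
  · push Not at h
    have h1 : 1 < x * M := by rwa [inv_eq_one_div, div_lt_iff₀ hM'] at h
    have hc : 1 < ⌈x * M⌉₊ := by rw [Nat.lt_ceil]; exact_mod_cast h1
    obtain ⟨k, hk⟩ : ∃ k, ⌈x * M⌉₊ = k + 1 := ⟨⌈x * M⌉₊ - 1, by omega⟩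
    have hle : ⌈x * M⌉₊ ≤ M := by
      rw [Nat.ceil_le]
      nlinarith [hx.2]
    refine ⟨k, mem_range.2 (by omega), ?_⟩
    rw [if_neg (by omega), ← hk, ← div_eq_mul_inv, ← div_eq_mul_inv]
    refine ⟨?_, ?_⟩
    · rw [div_lt_iff₀ hM']
      linarith [Nat.ceil_lt_add_one (show 0 ≤ x * M by linarith)]
    · rw [le_div_iff₀ hM']
      exact Nat.le_ceil _

/-- A function with few observation points in each subinterval has a small empirical
mean square when it is small in the Sobolev sense. -/
lemma sum_sq_le_of_histCount_le {M N : ℕ} (hM : 0 < M) (hN : 0 < N) {x : Fin N → ℝ}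
    (hx : ∀ i, x i ∈ Set.Icc (0 : ℝ) 1) {β : ℝ}
    (hup : ∀ j : ℕ, 1 ≤ j → j ≤ M →
      (histCount M N x j : ℝ) / ((N : ℝ) * (M : ℝ)⁻¹) ≤ β)
    {h h' : ℝ → ℝ}
    (hh : ∀ t ∈ Set.Icc (0 : ℝ) 1, HasDerivWithinAt h (h' t) (Set.Icc (0 : ℝ) 1) t)
    (hh' : ContinuousOn h' (Set.Icc (0 : ℝ) 1)) :
    (1 / (N : ℝ)) * ∑ i, h (x i) ^ 2 ≤
      β * (2 * (∫ t in (0 : ℝ)..1, h t ^ 2) +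
        ((M : ℝ)⁻¹) ^ 2 * ∫ t in (0 : ℝ)..1, h' t ^ 2) := by
  have hM' : (0 : ℝ) < M := Nat.cast_pos.2 hM
  have hN' : (0 : ℝ) < N := Nat.cast_pos.2 hN
  set d : ℝ := (M : ℝ)⁻¹ with hd_def
  have hd : 0 < d := inv_pos.2 hM'
  have hMd : (M : ℝ) * d = 1 := mul_inv_cancel₀ hM'.ne'
  have hc : ContinuousOn h (Set.Icc 0 1) := fun t ht => (hh t ht).continuousWithinAt
  set W : ℝ → ℝ := fun t => 2 * h t ^ 2 + d ^ 2 * h' t ^ 2 with hW_def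
  have hWc : ContinuousOn W (Set.Icc 0 1) := by fun_prop
  set B : ℕ → ℝ := fun k => ∫ t in (k * d)..((k + 1 : ℕ) * d), W t with hB_def
  have hlen : ∀ k : ℕ, ((k + 1 : ℕ) : ℝ) * d - k * d = d := fun k => by push_cast; ring
  have hsub : ∀ k < M, Set.Icc ((k : ℝ) * d) ((k + 1 : ℕ) * d) ⊆ Set.Icc 0 1 := by
    intro k hk
    refine Set.Icc_subset_Icc (by positivity) ?_
    rw [← hMd]
    gcongr
    exact hk
  have hlt : ∀ k : ℕ, (k : ℝ) * d < ((k + 1 : ℕ) : ℝ) * d := fun k => by linarith [hlen k]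
  have hB0 : ∀ k, 0 ≤ B k := fun k =>
    integral_nonneg (hlt k).le fun t _ => by positivity
  have hBsum : ∑ k ∈ range M, B k = ∫ t in (0 : ℝ)..1, W t := by
    rw [hB_def, sum_integral_adjacent_intervals (a := fun k : ℕ => (k : ℝ) * d)]
    · simp [hMd]
    · exact fun k hk => (hWc.mono (hsub k hk)).intervalIntegrable_of_Icc (hlt k).le
  let P : ℕ → Fin N → Prop := fun k i =>
    if k + 1 = 1 then x i ∈ Set.Icc (0 : ℝ) d
      else x i ∈ Set.Ioc ((((k + 1 : ℕ) : ℝ) - 1) * d) (((k + 1 : ℕ) : ℝ) * d)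
  have hpt : ∀ i, d * h (x i) ^ 2 ≤ ∑ k ∈ range M, if P k i then B k else 0 := by
    intro i
    obtain ⟨k, hk, hP⟩ := exists_subinterval_mem hM (hx i)
    have hmem : x i ∈ Set.Icc ((k : ℝ) * d) ((k + 1 : ℕ) * d) := by
      rcases Nat.eq_zero_or_pos k with rfl | hk0
      · simpa using hP
      · rw [if_neg (by omega)] at hP
        exact ⟨by simpa using hP.1.le, hP.2⟩
    have hkM := mem_range.1 hk
    have hsob := mul_sq_le_integral_sq_add_deriv_sq (hlt k)
      (fun t ht => (hh t (hsub k hkM ht)).mono (hsub k hkM)) (hh'.mono (hsub k hkM)) hmem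
    rw [hlen] at hsob
    calc d * h (x i) ^ 2 ≤ B k := hsob
      _ = if P k i then B k else 0 := (if_pos hP).symm
      _ ≤ _ := single_le_sum (f := fun k => if P k i then B k else 0)
          (fun k _ => by split_ifs <;> simp [hB0]) hk
  have hcount : ∀ k, ∑ i, (if P k i then B k else 0) = histCount M N x (k + 1) * B k := by
    intro k
    rw [← sum_filter, sum_const, nsmul_eq_mul]
    rfl
  have hkey : d * ∑ i, h (x i) ^ 2 ≤ (β * (N * d)) * ∫ t in (0 : ℝ)..1, W t := by
    calc d * ∑ i, h (x i) ^ 2 = ∑ i, d * h (x i) ^ 2 := mul_sum _ _ _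
      _ ≤ ∑ i, ∑ k ∈ range M, if P k i then B k else 0 := sum_le_sum fun i _ => hpt i
      _ = ∑ k ∈ range M, histCount M N x (k + 1) * B k := by
          rw [sum_comm]
          exact sum_congr rfl fun k _ => hcount k
      _ ≤ ∑ k ∈ range M, (β * (N * d)) * B k := by
          refine sum_le_sum fun k hk => mul_le_mul_of_nonneg_right ?_ (hB0 k)
          exact (div_le_iff₀ (by positivity)).1
            (hup (k + 1) (by omega) (mem_range.1 hk))
      _ = _ := by rw [← mul_sum, hBsum]
  have hWi : ∫ t in (0 : ℝ)..1, W t = 2 * (∫ t in (0 : ℝ)..1, h t ^ 2) +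
      d ^ 2 * ∫ t in (0 : ℝ)..1, h' t ^ 2 := by
    rw [hW_def, intervalIntegral.integral_add
      (((hc.fun_pow 2).intervalIntegrable_of_Icc zero_le_one).const_mul _)
      (((hh'.fun_pow 2).intervalIntegrable_of_Icc zero_le_one).const_mul _),
      intervalIntegral.integral_const_mul, intervalIntegral.integral_const_mul]
  rw [← hWi, one_div_mul_eq_div, div_le_iff₀ hN']
  refine le_of_mul_le_mul_left (hkey.trans_eq ?_) hd
  ring

/-- On `[0, 1]`, `∫ (u - v)² ≤ 2 ∫ u² + 2 ∫ v²`. -/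
lemma integral_sub_sq_le {u v : ℝ → ℝ} (hu : ContinuousOn u (Set.Icc 0 1))
    (hv : ContinuousOn v (Set.Icc 0 1)) :
    (∫ t in (0 : ℝ)..1, (u t - v t) ^ 2) ≤
      2 * (∫ t in (0 : ℝ)..1, u t ^ 2) + 2 * ∫ t in (0 : ℝ)..1, v t ^ 2 := by
  have hu2 := ((hu.fun_pow 2).intervalIntegrable_of_Icc (μ := volume) zero_le_one).const_mul 2
  have hv2 := ((hv.fun_pow 2).intervalIntegrable_of_Icc (μ := volume) zero_le_one).const_mul 2
  rw [← intervalIntegral.integral_const_mul, ← intervalIntegral.integral_const_mul,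
    ← intervalIntegral.integral_add hu2 hv2]
  refine integral_mono_on zero_le_one
    (((hu.sub hv).pow 2).intervalIntegrable_of_Icc zero_le_one) (hu2.add hv2) fun t _ => ?_
  nlinarith [sq_nonneg (u t + v t)]

/-- Under hypotheses (i)–(iv) of the noiseless-part lemma, if moreover
`σ > 0` and the regularization parameter is chosen as `α = Mσ²/N + d⁴`, then the mean
squared value of `g − f` at the observation points and `∫ (g″−f″)²` satisfy the stated
bounds. -/
theorem stmt7 (M N : ℕ) (hM : 0 < M) (hN : 0 < N)
    (x : Fin N → ℝ) (hx : ∀ i, x i ∈ Set.Icc (0 : ℝ) 1)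
    (α β σ : ℝ) (hα : 0 < α) (hβ : 0 < β) (hσ : 0 < σ)
    (hαchoice : α = (M : ℝ) * σ ^ 2 / (N : ℝ) + ((M : ℝ)⁻¹) ^ 4)
    (f f' f'' s s' s'' g g' g'' : ℝ → ℝ)
    (hf : ∀ t ∈ Set.Icc (0 : ℝ) 1, HasDerivWithinAt f (f' t) (Set.Icc (0 : ℝ) 1) t)
    (hf' : ∀ t ∈ Set.Icc (0 : ℝ) 1, HasDerivWithinAt f' (f'' t) (Set.Icc (0 : ℝ) 1) t)
    (hf'' : ContinuousOn f'' (Set.Icc (0 : ℝ) 1))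
    (hs : ∀ t ∈ Set.Icc (0 : ℝ) 1, HasDerivWithinAt s (s' t) (Set.Icc (0 : ℝ) 1) t)
    (hs' : ∀ t ∈ Set.Icc (0 : ℝ) 1, HasDerivWithinAt s' (s'' t) (Set.Icc (0 : ℝ) 1) t)
    (hs'' : ContinuousOn s'' (Set.Icc (0 : ℝ) 1))
    (hg : ∀ t ∈ Set.Icc (0 : ℝ) 1, HasDerivWithinAt g (g' t) (Set.Icc (0 : ℝ) 1) t)
    (hg' : ∀ t ∈ Set.Icc (0 : ℝ) 1, HasDerivWithinAt g' (g'' t) (Set.Icc (0 : ℝ) 1) t)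
    (hg'' : ContinuousOn g'' (Set.Icc (0 : ℝ) 1))
    -- (i) the histogram is bounded above by β
    (hup : ∀ j : ℕ, 1 ≤ j → j ≤ M →
      (histCount M N x j : ℝ) / ((N : ℝ) * (M : ℝ)⁻¹) ≤ β)
    -- (ii) interpolation-error estimates for s
    (hii₁ : (∫ t in (0 : ℝ)..1, (s t - f t) ^ 2) ≤
      (((M : ℝ)⁻¹) ^ 4 / 16) * ∫ t in (0 : ℝ)..1, (f'' t) ^ 2)
    (hii₂ : (∫ t in (0 : ℝ)..1, (s' t - f' t) ^ 2) ≤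
      (((M : ℝ)⁻¹) ^ 2 / 2) * ∫ t in (0 : ℝ)..1, (f'' t) ^ 2)
    -- (iii) Pythagorean-type bound
    (hiii : (∫ t in (0 : ℝ)..1, (s'' t) ^ 2) ≤ ∫ t in (0 : ℝ)..1, (f'' t) ^ 2)
    -- (iv) J(g) ≤ J(s)
    (hiv : (1 / (N : ℝ)) * (∑ i, (g (x i) - f (x i)) ^ 2)
        + α * (∫ t in (0 : ℝ)..1, (g'' t) ^ 2) ≤
      (1 / (N : ℝ)) * (∑ i, (s (x i) - f (x i)) ^ 2)
        + α * ∫ t in (0 : ℝ)..1, (s'' t) ^ 2) :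
    (1 / (N : ℝ)) * (∑ i, (g (x i) - f (x i)) ^ 2) ≤
        ((M : ℝ) * σ ^ 2 / (N : ℝ)) * (∫ t in (0 : ℝ)..1, (f'' t) ^ 2)
          + ((M : ℝ)⁻¹) ^ 4 * ((9 / 8) * β + 1) * (∫ t in (0 : ℝ)..1, (f'' t) ^ 2) ∧
    (∫ t in (0 : ℝ)..1, (g'' t - f'' t) ^ 2) ≤
        ((9 / 4) * β + 4) * ∫ t in (0 : ℝ)..1, (f'' t) ^ 2 := by
  have hN' : (0 : ℝ) < N := Nat.cast_pos.2 hN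
  have hd : (0 : ℝ) < (M : ℝ)⁻¹ := inv_pos.2 (Nat.cast_pos.2 hM)
  have hf'c : ContinuousOn f' (Set.Icc 0 1) := fun t ht => (hf' t ht).continuousWithinAt
  have hs'c : ContinuousOn s' (Set.Icc 0 1) := fun t ht => (hs' t ht).continuousWithinAt
  have hsum := sum_sq_le_of_histCount_le hM hN hx hup
    (h := fun t => s t - f t) (h' := fun t => s' t - f' t)
    (fun t ht => (hs t ht).sub (hf t ht)) (hs'c.sub hf'c)
  have hgf := integral_sub_sq_le hg'' hf''
  set d : ℝ := (M : ℝ)⁻¹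
  set I : ℝ := ∫ t in (0 : ℝ)..1, f'' t ^ 2
  set G : ℝ := ∫ t in (0 : ℝ)..1, g'' t ^ 2
  have hI : 0 ≤ I := integral_nonneg zero_le_one fun t _ => sq_nonneg _
  have hG : 0 ≤ G := integral_nonneg zero_le_one fun t _ => sq_nonneg _
  have hsamp : (1 / (N : ℝ)) * ∑ i, (s (x i) - f (x i)) ^ 2 ≤ 9 / 8 * β * d ^ 4 * I := by
    refine hsum.trans ?_
    calc _ ≤ β * (2 * (d ^ 4 / 16 * I) + d ^ 2 * (d ^ 2 / 2 * I)) := by gcongr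
      _ = 5 / 8 * (β * d ^ 4 * I) := by ring
      _ ≤ 9 / 8 * (β * d ^ 4 * I) := by gcongr; norm_num
      _ = _ := by ring
  have hpen := mul_le_mul_of_nonneg_left hiii hα.le
  have hαG : 0 ≤ α * G := mul_nonneg hα.le hG
  have hgsum : 0 ≤ (1 / (N : ℝ)) * ∑ i, (g (x i) - f (x i)) ^ 2 := by positivity
  have hdα : d ^ 4 ≤ α := by
    rw [hαchoice]
    exact le_add_of_nonneg_left (by positivity)
  refine ⟨?_, ?_⟩
  · calc (1 / (N : ℝ)) * ∑ i, (g (x i) - f (x i)) ^ 2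
        ≤ 9 / 8 * β * d ^ 4 * I + α * I := by linarith
      _ = _ := by rw [hαchoice]; ring
  · have hGI : G ≤ (9 / 8 * β + 1) * I := by
      refine le_of_mul_le_mul_left ?_ hα
      calc α * G ≤ d ^ 4 * (9 / 8 * β * I) + α * I := by linarith
        _ ≤ α * (9 / 8 * β * I) + α * I := by gcongr
        _ = _ := by ring
    linarith
end

section
/- Let S ∈ ℝ^{N×N} be a symmetric positive semidefinite matrix whose rank is at most k, and let c > 0. Then the matrix cI + S is invertible and the trace of S(cI + S)⁻² is at most k/(4c). -/
open Matrix

/-- For a matrix diagonalized as `U * diagonal d * V` with `V = U⁻¹`, the function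
`S ↦ S * (c • 1 + S)⁻¹ ^ 2` acts on the diagonal entries. -/
theorem isUnit_and_trace_mul_inv_sq_of_diagonalization {n K : Type*} [Fintype n] [DecidableEq n]
    [Field K] {U V : Matrix n n K} (hUV : U * V = 1) (d : n → K) (c : K)
    (hd : ∀ i, c + d i ≠ 0) :
    IsUnit (c • (1 : Matrix n n K) + U * diagonal d * V) ∧
      trace (U * diagonal d * V * ((c • (1 : Matrix n n K) + U * diagonal d * V)⁻¹) ^ 2) =
        ∑ i, d i / (c + d i) ^ 2 := by
  have hVU : V * U = 1 := mul_eq_one_comm.mp hUV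
  have conj_mul (a b : n → K) : U * diagonal a * V * (U * diagonal b * V) =
      U * diagonal (fun i => a i * b i) * V := by
    rw [← diagonal_mul_diagonal]
    simp only [Matrix.mul_assoc]
    rw [← Matrix.mul_assoc V U, hVU, Matrix.one_mul]
  have hsum : c • (1 : Matrix n n K) + U * diagonal d * V =
      U * diagonal (fun i => c + d i) * V := by
    rw [← diagonal_add, ← smul_one_eq_diagonal, Matrix.mul_add, Matrix.add_mul,
      Matrix.mul_smul, Matrix.smul_mul, Matrix.mul_one, hUV]
  have hinv : U * diagonal (fun i => c + d i) * V * (U * diagonal (fun i => (c + d i)⁻¹) * V) =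
      1 := by
    rw [conj_mul]
    simp [hd, hUV]
  rw [hsum]
  refine ⟨IsUnit.of_mul_eq_one _ hinv, ?_⟩
  rw [inv_eq_right_inv hinv, pow_two, conj_mul, conj_mul, trace_mul_comm, ← Matrix.mul_assoc,
    hVU, Matrix.one_mul, trace_diagonal]
  exact Finset.sum_congr rfl fun i _ => by rw [div_eq_mul_inv, ← inv_pow, pow_two]

theorem div_add_sq_le_inv_four_mul {c t : ℝ} (hc : 0 < c) (ht : 0 ≤ t) :
    t / (c + t) ^ 2 ≤ 1 / (4 * c) := by
  rw [div_le_div_iff₀ (by positivity) (by positivity)]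
  nlinarith [sq_nonneg (c - t)]

/-- For a symmetric positive semidefinite `S ∈ ℝ^{N×N}` of rank at
most `k` and `c > 0`, the matrix `cI + S` is invertible and
`tr(S(cI + S)⁻²) ≤ k/(4c)`. -/
theorem stmt9 (N k : ℕ) (S : Matrix (Fin N) (Fin N) ℝ) (hS : S.PosSemidef)
    (hrank : S.rank ≤ k) (c : ℝ) (hc : 0 < c) :
    IsUnit (c • (1 : Matrix (Fin N) (Fin N) ℝ) + S) ∧
      Matrix.trace (S * ((c • (1 : Matrix (Fin N) (Fin N) ℝ) + S)⁻¹) ^ 2) ≤ (k : ℝ) / (4 * c) := by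
  have hd : ∀ i, 0 ≤ hS.isHermitian.eigenvalues i := hS.eigenvalues_nonneg
  have hspec : S = (hS.isHermitian.eigenvectorUnitary : Matrix (Fin N) (Fin N) ℝ) *
      diagonal hS.isHermitian.eigenvalues *
        ((star hS.isHermitian.eigenvectorUnitary : unitaryGroup (Fin N) ℝ) :
          Matrix (Fin N) (Fin N) ℝ) :=
    hS.isHermitian.spectral_theorem
  obtain ⟨hunit, htrace⟩ := isUnit_and_trace_mul_inv_sq_of_diagonalization
    (Unitary.coe_mul_star_self hS.isHermitian.eigenvectorUnitary) hS.isHermitian.eigenvalues c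
    fun i => (add_pos_of_pos_of_nonneg hc (hd i)).ne'
  rw [← hspec] at hunit htrace
  refine ⟨hunit, ?_⟩
  rw [hS.isHermitian.rank_eq_card_non_zero_eigs, Fintype.card_subtype] at hrank
  calc _ = ∑ i, hS.isHermitian.eigenvalues i / (c + hS.isHermitian.eigenvalues i) ^ 2 := htrace
    _ = ∑ i with hS.isHermitian.eigenvalues i ≠ 0,
        hS.isHermitian.eigenvalues i / (c + hS.isHermitian.eigenvalues i) ^ 2 := by
      refine (Finset.sum_filter_of_ne fun i _ h => ?_).symm
      exact (div_ne_zero_iff.mp h).1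
    _ ≤ ∑ i with hS.isHermitian.eigenvalues i ≠ 0, 1 / (4 * c) :=
      Finset.sum_le_sum fun i _ => div_add_sq_le_inv_four_mul hc (hd i)
    _ ≤ k / (4 * c) := by
      rw [Finset.sum_const, nsmul_eq_mul, mul_one_div]
      gcongr
end

section
/- Let M ≥ 3 and N be positive integers with N ≥ M, d = 1/M, σ > 0, δ ∈ (0,1), β > 0, γ > 0, F ≥ 0. Let p, q be integers with 0 ≤ p < q ≤ M and q − p ≥ 2√32, set I′ = (pd, qd), and suppose N_j/(N d) ≥ γ for every j with p+1 ≤ j ≤ q. Let u₁, u₂ : [0,1] → ℝ be twice continuously differentiable with (1/N)·Σ_{i=1}^N u₁(x_i)² ≤ (Mσ²/N)·F² + d⁴·((9/8)β + 1)·F², ∫_0^1 u₁″(x)² dx ≤ ((9/4)β + 4)·F², (1/N)·Σ_{i=1}^N u₂(x_i)² ≤ 4σ²M/(δN), and ∫_0^1 u₂″(x)² dx ≤ 1/δ, and suppose that for v ∈ {u₁, u₂} and every ε ∈ (0, (q−p)d], ∫_{I′} v′(x)² dx ≤ 32( ε⁻²·∫_{I′} v(x)² dx + ε²·∫_{I′}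 v″(x)² dx ). Then ( ∫_{I′} (u₁(x) + u₂(x))² dx )^{1/2} ≤ C₁·(Mσ²/N)^{1/2} + C₂·M⁻², where C₁ = 2γ^{−1/2}·F + 4/√(δγ) and C₂ = F·√( (9β+8)/(2γ) + 36·32²·β + 64·32² ) + 4·32·δ^{−1/2}. -/
open MeasureTheory Finset intervalIntegral
open scoped Classical

/-- Cauchy–Schwarz control of the increment of a `C¹` function by the `L²` norm of its derivative. -/
lemma sq_sub_le_mul_integral_sq_deriv_s17 {f f' : ℝ → ℝ} {a b s t : ℝ}
    (hf : ∀ r ∈ Set.Icc a b, HasDerivWithinAt f (f' r) (Set.Icc a b) r)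
    (hf' : ContinuousOn f' (Set.Icc a b)) (has : a ≤ s) (hst : s ≤ t) (htb : t ≤ b) :
    (f t - f s) ^ 2 ≤ (b - a) * ∫ r in a..b, (f' r) ^ 2 := by
  have hab : a ≤ b := has.trans (hst.trans htb)
  have hsub : Set.Icc s t ⊆ Set.Icc a b := Set.Icc_subset_Icc has htb
  have hint : IntervalIntegrable f' volume s t :=
    (hf'.mono hsub).intervalIntegrable_of_Icc hst
  have hint2 : IntervalIntegrable (fun r => (f' r) ^ 2) volume s t :=
    ((hf'.mono hsub).pow 2).intervalIntegrable_of_Icc hst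
  have hint2' : IntervalIntegrable (fun r => (f' r) ^ 2) volume a b :=
    (hf'.pow 2).intervalIntegrable_of_Icc hab
  have hnonneg : 0 ≤ ∫ r in a..b, (f' r) ^ 2 :=
    integral_nonneg hab fun r _ => sq_nonneg _
  rcases hst.eq_or_lt with rfl | hlt
  · simpa using mul_nonneg (sub_nonneg.2 hab) hnonneg
  have hftc : ∫ r in s..t, f' r = f t - f s := by
    refine integral_eq_sub_of_hasDerivAt_of_le hst
      (fun r hr => ((hf r (hsub hr)).continuousWithinAt).mono hsub) (fun r hr => ?_) hint
    exact (hf r (hsub (Set.Ioo_subset_Icc_self hr))).hasDerivAt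
      (Icc_mem_nhds (has.trans_lt hr.1) (hr.2.trans_le htb))
  have hL : 0 < t - s := sub_pos.2 hlt
  have hmono : ∫ r in s..t, (f' r) ^ 2 ≤ ∫ r in a..b, (f' r) ^ 2 :=
    integral_mono_interval has hst htb (Filter.Eventually.of_forall fun r => sq_nonneg _) hint2'
  have hvar : 0 ≤ ∫ r in s..t, ((t - s) * f' r - (f t - f s)) ^ 2 :=
    integral_nonneg hst fun r _ => sq_nonneg _
  have hexp : ∫ r in s..t, ((t - s) * f' r - (f t - f s)) ^ 2
      = (t - s) * ((t - s) * (∫ r in s..t, (f' r) ^ 2) - (f t - f s) ^ 2) := by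
    have : ∀ r, ((t - s) * f' r - (f t - f s)) ^ 2
        = (t - s) ^ 2 * (f' r) ^ 2 - 2 * (t - s) * (f t - f s) * f' r + (f t - f s) ^ 2 :=
      fun r => by ring
    simp_rw [this]
    rw [integral_add ((hint2.const_mul _).sub (hint.const_mul _)) intervalIntegrable_const,
      integral_sub (hint2.const_mul _) (hint.const_mul _), intervalIntegral.integral_const_mul,
      intervalIntegral.integral_const_mul, hftc, intervalIntegral.integral_const, smul_eq_mul]
    ring
  rw [hexp] at hvar
  have := nonneg_of_mul_nonneg_right hvar hL
  calc (f t - f s) ^ 2 ≤ (t - s) * ∫ r in s..t, (f' r) ^ 2 := by linarith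
    _ ≤ (b - a) * ∫ r in a..b, (f' r) ^ 2 :=
      mul_le_mul (by linarith) hmono (integral_nonneg hst fun r _ => sq_nonneg _) (by linarith)

lemma integral_sq_le_sampled_add {f f' : ℝ → ℝ} {a b s : ℝ}
    (hf : ∀ r ∈ Set.Icc a b, HasDerivWithinAt f (f' r) (Set.Icc a b) r)
    (hf' : ContinuousOn f' (Set.Icc a b)) (hs : s ∈ Set.Icc a b) :
    ∫ r in a..b, (f r) ^ 2 ≤
      2 * (b - a) * (f s) ^ 2 + 2 * (b - a) ^ 2 * ∫ r in a..b, (f' r) ^ 2 := by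
  have hab : a ≤ b := hs.1.trans hs.2
  have hcont : ContinuousOn f (Set.Icc a b) := fun r hr => (hf r hr).continuousWithinAt
  have hle : ∫ r in a..b, (f r) ^ 2 ≤
      ∫ _ in a..b, (2 * (f s) ^ 2 + 2 * ((b - a) * ∫ r in a..b, (f' r) ^ 2)) := by
    refine integral_mono_on hab ((hcont.pow 2).intervalIntegrable_of_Icc hab)
      intervalIntegrable_const fun r hr => ?_
    have hinc : (f r - f s) ^ 2 ≤ (b - a) * ∫ r in a..b, (f' r) ^ 2 := by
      rcases le_total s r with h | h
      · exact sq_sub_le_mul_integral_sq_deriv_s17 hf hf' hs.1 h hr.2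
      · rw [← neg_sub, neg_sq]
        exact sq_sub_le_mul_integral_sq_deriv_s17 hf hf' hr.1 h hs.2
    nlinarith [sq_nonneg (f r - 2 * f s)]
  rw [intervalIntegral.integral_const, smul_eq_mul] at hle
  linarith

/-- Minkowski's inequality for continuous functions on a compact interval. -/
lemma sqrt_integral_sq_add_le {f g : ℝ → ℝ} {a b : ℝ} (hab : a ≤ b)
    (hf : ContinuousOn f (Set.Icc a b)) (hg : ContinuousOn g (Set.Icc a b)) :
    √(∫ t in a..b, (f t + g t) ^ 2) ≤
      √(∫ t in a..b, (f t) ^ 2) + √(∫ t in a..b, (g t) ^ 2) := by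
  have hff : IntervalIntegrable (fun t => (f t) ^ 2) volume a b :=
    (hf.pow 2).intervalIntegrable_of_Icc hab
  have hgg : IntervalIntegrable (fun t => (g t) ^ 2) volume a b :=
    (hg.pow 2).intervalIntegrable_of_Icc hab
  have hfg : IntervalIntegrable (fun t => f t * g t) volume a b :=
    (hf.mul hg).intervalIntegrable_of_Icc hab
  set A := ∫ t in a..b, (f t) ^ 2 with hA
  set B := ∫ t in a..b, (g t) ^ 2 with hB
  set P := ∫ t in a..b, f t * g t with hP
  have hexp : ∀ c : ℝ, ∫ t in a..b, (f t + c * g t) ^ 2 = A + 2 * c * P + c ^ 2 * B := by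
    intro c
    have : ∀ t, (f t + c * g t) ^ 2
        = (f t) ^ 2 + 2 * c * (f t * g t) + c ^ 2 * (g t) ^ 2 := fun t => by ring
    simp_rw [this]
    rw [integral_add (hff.add (hfg.const_mul _)) (hgg.const_mul _),
      integral_add hff (hfg.const_mul _), intervalIntegral.integral_const_mul, intervalIntegral.integral_const_mul]
  have hA0 : 0 ≤ A := integral_nonneg hab fun t _ => sq_nonneg _
  have hB0 : 0 ≤ B := integral_nonneg hab fun t _ => sq_nonneg _
  have hdisc : discrim B (2 * P) A ≤ 0 := discrim_le_zero fun c => by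
    have h0 : 0 ≤ ∫ t in a..b, (f t + c * g t) ^ 2 := integral_nonneg hab fun t _ => sq_nonneg _
    rw [hexp c] at h0
    linarith
  have hPAB : P ≤ √A * √B := by
    rw [← Real.sqrt_mul hA0]
    refine Real.le_sqrt_of_sq_le ?_
    rw [discrim] at hdisc
    linarith
  have h1 := hexp 1
  simp only [one_mul] at h1
  rw [h1]
  refine Real.sqrt_le_iff.2 ⟨by positivity, ?_⟩
  nlinarith [Real.sq_sqrt hA0, Real.sq_sqrt hB0]

/-- The sample points counted by `histCount`. -/
noncomputable def histCell (M N : ℕ) (x : Fin N → ℝ) (j : ℕ) : Finset (Fin N) :=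
  Finset.univ.filter fun i : Fin N =>
    if j = 1 then x i ∈ Set.Icc (0 : ℝ) ((M : ℝ)⁻¹)
    else x i ∈ Set.Ioc (((j : ℝ) - 1) * (M : ℝ)⁻¹) ((j : ℝ) * (M : ℝ)⁻¹)

lemma card_histCell (M N : ℕ) (x : Fin N → ℝ) (j : ℕ) :
    (histCell M N x j).card = histCount M N x j := rfl

lemma mem_Icc_of_mem_histCell {M N : ℕ} {x : Fin N → ℝ} {k : ℕ} {i : Fin N}
    (hi : i ∈ histCell M N x (k + 1)) :
    x i ∈ Set.Icc ((k : ℝ) * (M : ℝ)⁻¹) (((k + 1 : ℕ) : ℝ) * (M : ℝ)⁻¹) := by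
  simp only [histCell, Finset.mem_filter, Finset.mem_univ, true_and] at hi
  split_ifs at hi with h
  · obtain rfl : k = 0 := by omega
    simpa using hi
  · push_cast at hi ⊢
    rw [add_sub_cancel_right] at hi
    exact Set.Ioc_subset_Icc_self hi

lemma disjoint_histCell_of_lt {M N : ℕ} {x : Fin N → ℝ} {j k : ℕ} (hjk : j < k) :
    Disjoint (histCell M N x (j + 1)) (histCell M N x (k + 1)) := by
  rw [Finset.disjoint_left]
  intro i hij hik
  have h1 := (mem_Icc_of_mem_histCell hij).2
  simp only [histCell, Finset.mem_filter, Finset.mem_univ, true_and] at hik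
  rw [if_neg (by omega)] at hik
  have h2 := hik.1
  push_cast at h2
  rw [add_sub_cancel_right] at h2
  have h3 : ((j + 1 : ℕ) : ℝ) * (M : ℝ)⁻¹ ≤ (k : ℝ) * (M : ℝ)⁻¹ := by
    gcongr
    exact hjk
  linarith

lemma sum_sum_histCell_le {M N : ℕ} {x : Fin N → ℝ} (p q : ℕ) {g : Fin N → ℝ}
    (hg : ∀ i, 0 ≤ g i) :
    ∑ k ∈ Finset.Ico p q, ∑ i ∈ histCell M N x (k + 1), g i ≤ ∑ i, g i := by
  rw [← Finset.sum_biUnion]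
  · exact Finset.sum_le_sum_of_subset_of_nonneg (Finset.subset_univ _) fun i _ _ => hg i
  · intro j _ k _ hjk
    rcases lt_or_gt_of_ne hjk with h | h
    · exact disjoint_histCell_of_lt h
    · exact (disjoint_histCell_of_lt h).symm

lemma integral_sq_le_of_le_histCount {M N : ℕ} (hM : 0 < M) (hN : 0 < N) {γ : ℝ} (hγ : 0 < γ)
    {x : Fin N → ℝ} {p q : ℕ} (hpq : p ≤ q) (hqM : q ≤ M)
    (hlow : ∀ j : ℕ, p + 1 ≤ j → j ≤ q →
      γ ≤ (histCount M N x j : ℝ) / ((N : ℝ) * (M : ℝ)⁻¹))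
    {v v' : ℝ → ℝ}
    (hv : ∀ t ∈ Set.Icc (0 : ℝ) 1, HasDerivWithinAt v (v' t) (Set.Icc (0 : ℝ) 1) t)
    (hv' : ContinuousOn v' (Set.Icc (0 : ℝ) 1)) :
    (∫ t in ((p : ℝ) * (M : ℝ)⁻¹)..((q : ℝ) * (M : ℝ)⁻¹), (v t) ^ 2) ≤
      2 / γ * ((1 / (N : ℝ)) * ∑ i, (v (x i)) ^ 2) + 2 * ((M : ℝ)⁻¹) ^ 2 *
        ∫ t in ((p : ℝ) * (M : ℝ)⁻¹)..((q : ℝ) * (M : ℝ)⁻¹), (v' t) ^ 2 := by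
  have hMr : (0 : ℝ) < M := by exact_mod_cast hM
  have hNr : (0 : ℝ) < N := by exact_mod_cast hN
  have hd : (0 : ℝ) < (M : ℝ)⁻¹ := inv_pos.2 hMr
  have hcont : ContinuousOn v (Set.Icc 0 1) := fun r hr => (hv r hr).continuousWithinAt
  have hle : ∀ k : ℕ, (k : ℝ) * (M : ℝ)⁻¹ ≤ ((k + 1 : ℕ) : ℝ) * (M : ℝ)⁻¹ := fun k => by
    gcongr; simp
  have hsub : ∀ k ∈ Set.Ico p q, Set.Icc ((k : ℝ) * (M : ℝ)⁻¹) (((k + 1 : ℕ) : ℝ) * (M : ℝ)⁻¹)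
      ⊆ Set.Icc 0 1 := fun k hk => by
    refine Set.Icc_subset_Icc (by positivity) ?_
    rw [← div_eq_mul_inv, div_le_one hMr]
    exact_mod_cast (show k + 1 ≤ q from hk.2).trans hqM
  have hcell : ∀ k ∈ Finset.Ico p q,
      (∫ t in ((k : ℝ) * (M : ℝ)⁻¹)..(((k + 1 : ℕ) : ℝ) * (M : ℝ)⁻¹), (v t) ^ 2) ≤
        2 / (γ * N) * (∑ i ∈ histCell M N x (k + 1), (v (x i)) ^ 2) + 2 * ((M : ℝ)⁻¹) ^ 2 *
          ∫ t in ((k : ℝ) * (M : ℝ)⁻¹)..(((k + 1 : ℕ) : ℝ) * (M : ℝ)⁻¹), (v' t) ^ 2 := by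
    intro k hk
    rw [Finset.mem_Ico] at hk
    have hcount := hlow (k + 1) (by omega) (by omega)
    rw [← card_histCell, le_div_iff₀ (by positivity)] at hcount
    set A := ∫ t in ((k : ℝ) * (M : ℝ)⁻¹)..(((k + 1 : ℕ) : ℝ) * (M : ℝ)⁻¹), (v t) ^ 2
    set B := ∫ t in ((k : ℝ) * (M : ℝ)⁻¹)..(((k + 1 : ℕ) : ℝ) * (M : ℝ)⁻¹), (v' t) ^ 2
    set n : ℝ := ((histCell M N x (k + 1)).card : ℝ)
    set S := ∑ i ∈ histCell M N x (k + 1), (v (x i)) ^ 2 with hS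
    have hn : 0 < n := lt_of_lt_of_le (by positivity) hcount
    have hS0 : 0 ≤ S := Finset.sum_nonneg fun i _ => sq_nonneg _
    have hpt : ∀ i ∈ histCell M N x (k + 1),
        A - 2 * ((M : ℝ)⁻¹) ^ 2 * B ≤ 2 * (M : ℝ)⁻¹ * (v (x i)) ^ 2 := by
      intro i hi
      have := integral_sq_le_sampled_add
        (fun r hr => (hv r (hsub k hk hr)).mono (hsub k hk)) (hv'.mono (hsub k hk))
        (mem_Icc_of_mem_histCell hi)
      have hlen : ((k + 1 : ℕ) : ℝ) * (M : ℝ)⁻¹ - (k : ℝ) * (M : ℝ)⁻¹ = (M : ℝ)⁻¹ := by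
        push_cast; ring
      rw [hlen] at this
      linarith
    have hsum := Finset.card_nsmul_le_sum _ _ _ (fun i hi => sub_nonneg.2 (hpt i hi))
    simp only [smul_zero, Finset.sum_sub_distrib, Finset.sum_const, nsmul_eq_mul,
      ← Finset.mul_sum, ← hS] at hsum
    have hmain : A - 2 * ((M : ℝ)⁻¹) ^ 2 * B ≤ 2 * (M : ℝ)⁻¹ * S / n := by
      rw [le_div_iff₀ hn]
      linarith
    have hbound : 2 * (M : ℝ)⁻¹ * S / n ≤ 2 * (M : ℝ)⁻¹ * S / (γ * (N * (M : ℝ)⁻¹)) := by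
      gcongr
    have heq : 2 * (M : ℝ)⁻¹ * S / (γ * (N * (M : ℝ)⁻¹)) = 2 / (γ * N) * S := by
      field_simp
    linarith
  have hadj : ∀ w : ℝ → ℝ, ContinuousOn w (Set.Icc 0 1) →
      ∑ k ∈ Finset.Ico p q,
        (∫ t in ((k : ℝ) * (M : ℝ)⁻¹)..(((k + 1 : ℕ) : ℝ) * (M : ℝ)⁻¹), (w t) ^ 2) =
        ∫ t in ((p : ℝ) * (M : ℝ)⁻¹)..((q : ℝ) * (M : ℝ)⁻¹), (w t) ^ 2 := fun w hw =>
    sum_integral_adjacent_intervals_Ico (a := fun k : ℕ => (k : ℝ) * (M : ℝ)⁻¹) hpq fun k hk =>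
      ((hw.mono (hsub k hk)).pow 2).intervalIntegrable_of_Icc (hle k)
  have htotal := Finset.sum_le_sum hcell
  rw [Finset.sum_add_distrib, ← Finset.mul_sum, ← Finset.mul_sum, hadj v hcont,
    hadj v' hv'] at htotal
  have hsamples := mul_le_mul_of_nonneg_left
    (sum_sum_histCell_le (M := M) (x := x) p q (g := fun i => (v (x i)) ^ 2)
      fun i => sq_nonneg _) (show 0 ≤ 2 / (γ * N) by positivity)
  have heq : 2 / (γ * N) * ∑ i, (v (x i)) ^ 2
      = 2 / γ * ((1 / (N : ℝ)) * ∑ i, (v (x i)) ^ 2) := by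
    field_simp
  linarith

lemma integral_sq_le_of_interpolation {M N : ℕ} (hM : 0 < M) (hN : 0 < N) {γ : ℝ} (hγ : 0 < γ)
    {x : Fin N → ℝ} {p q : ℕ} (hpq : p ≤ q) (hqM : q ≤ M)
    (hgap : 2 * √32 ≤ (q : ℝ) - (p : ℝ))
    (hlow : ∀ j : ℕ, p + 1 ≤ j → j ≤ q →
      γ ≤ (histCount M N x j : ℝ) / ((N : ℝ) * (M : ℝ)⁻¹))
    {v v' v'' : ℝ → ℝ}
    (hv : ∀ t ∈ Set.Icc (0 : ℝ) 1, HasDerivWithinAt v (v' t) (Set.Icc (0 : ℝ) 1) t)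
    (hv' : ContinuousOn v' (Set.Icc (0 : ℝ) 1)) (hv'' : ContinuousOn v'' (Set.Icc (0 : ℝ) 1))
    (hsobolev : ∀ ε : ℝ, 0 < ε → ε ≤ ((q : ℝ) - (p : ℝ)) * (M : ℝ)⁻¹ →
      (∫ t in Set.Ioo ((p : ℝ) * (M : ℝ)⁻¹) ((q : ℝ) * (M : ℝ)⁻¹), (v' t) ^ 2) ≤
        32 * ((ε ^ 2)⁻¹ *
            (∫ t in Set.Ioo ((p : ℝ) * (M : ℝ)⁻¹) ((q : ℝ) * (M : ℝ)⁻¹), (v t) ^ 2)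
          + ε ^ 2 *
            ∫ t in Set.Ioo ((p : ℝ) * (M : ℝ)⁻¹) ((q : ℝ) * (M : ℝ)⁻¹), (v'' t) ^ 2)) :
    (∫ t in ((p : ℝ) * (M : ℝ)⁻¹)..((q : ℝ) * (M : ℝ)⁻¹), (v t) ^ 2) ≤
      4 / γ * ((1 / (N : ℝ)) * ∑ i, (v (x i)) ^ 2) +
        16 * 32 ^ 2 * ((M : ℝ)⁻¹) ^ 4 * ∫ t in (0 : ℝ)..1, (v'' t) ^ 2 := by
  have hMr : (0 : ℝ) < M := by exact_mod_cast hM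
  have hab : (p : ℝ) * (M : ℝ)⁻¹ ≤ (q : ℝ) * (M : ℝ)⁻¹ := by gcongr
  have hb : (q : ℝ) * (M : ℝ)⁻¹ ≤ 1 := by
    rw [← div_eq_mul_inv, div_le_one hMr]
    exact_mod_cast hqM
  have hsample := integral_sq_le_of_le_histCount hM hN hγ hpq hqM hlow hv hv'
  have hsob := hsobolev (2 * √32 * (M : ℝ)⁻¹) (by positivity) (by gcongr)
  simp only [← integral_Ioc_eq_integral_Ioo, ← integral_of_le hab] at hsob
  have hε : (2 * √32 * (M : ℝ)⁻¹) ^ 2 = 128 * ((M : ℝ)⁻¹) ^ 2 := by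
    rw [mul_pow, mul_pow, Real.sq_sqrt (by norm_num)]
    norm_num
  rw [hε] at hsob
  have hmono : ∫ t in ((p : ℝ) * (M : ℝ)⁻¹)..((q : ℝ) * (M : ℝ)⁻¹), (v'' t) ^ 2
      ≤ ∫ t in (0 : ℝ)..1, (v'' t) ^ 2 :=
    integral_mono_interval (by positivity) hab hb
      (Filter.Eventually.of_forall fun r => sq_nonneg _)
      ((hv''.pow 2).intervalIntegrable_of_Icc zero_le_one)
  set A := ∫ t in ((p : ℝ) * (M : ℝ)⁻¹)..((q : ℝ) * (M : ℝ)⁻¹), (v t) ^ 2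
  set C := ∫ t in ((p : ℝ) * (M : ℝ)⁻¹)..((q : ℝ) * (M : ℝ)⁻¹), (v'' t) ^ 2
  have hscaled := mul_le_mul_of_nonneg_left hsob (show 0 ≤ 2 * ((M : ℝ)⁻¹) ^ 2 by positivity)
  have hsimp : 2 * ((M : ℝ)⁻¹) ^ 2 *
      (32 * ((128 * ((M : ℝ)⁻¹) ^ 2)⁻¹ * A + 128 * ((M : ℝ)⁻¹) ^ 2 * C))
      = A / 2 + 8192 * ((M : ℝ)⁻¹) ^ 4 * C := by
    field_simp
    ring
  rw [hsimp] at hscaled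
  have hmono' := mul_le_mul_of_nonneg_left hmono
    (show 0 ≤ 16384 * ((M : ℝ)⁻¹) ^ 4 by positivity)
  have hsplit : ∀ T : ℝ, 4 / γ * T = 2 * (2 / γ * T) := fun T => by ring
  rw [hsplit]
  linarith

/-- Error bound in the continuous `L²` norm for the reconstructed
function on a reliable subinterval `I′ = (pd, qd)`: with `u₁` the deterministic error
part and `u₂` the noise part (satisfying the bounds established for these parts, and
the Sobolev interpolation inequality with constant `K* = 32` on `I′`),
`‖u₁ + u₂‖_{L²(I′)} ≤ C₁·(Mσ²/N)^{1/2} + C₂·M⁻²`. -/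
theorem stmt17 (M N : ℕ) (hM : 3 ≤ M) (hNM : M ≤ N)
    (σ δ β γ F : ℝ) (hσ : 0 < σ) (hδ₀ : 0 < δ) (hδ₁ : δ < 1)
    (hβ : 0 < β) (hγ : 0 < γ) (hF : 0 ≤ F)
    (x : Fin N → ℝ) (hx : ∀ i, x i ∈ Set.Icc (0 : ℝ) 1)
    (p q : ℕ) (hpq : p < q) (hqM : q ≤ M)
    (hgap : 2 * Real.sqrt 32 ≤ (q : ℝ) - (p : ℝ))
    (hlow : ∀ j : ℕ, p + 1 ≤ j → j ≤ q →
      γ ≤ (histCount M N x j : ℝ) / ((N : ℝ) * (M : ℝ)⁻¹))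
    (u₁ u₁' u₁'' u₂ u₂' u₂'' : ℝ → ℝ)
    (hu₁ : ∀ t ∈ Set.Icc (0 : ℝ) 1, HasDerivWithinAt u₁ (u₁' t) (Set.Icc (0 : ℝ) 1) t)
    (hu₁' : ∀ t ∈ Set.Icc (0 : ℝ) 1, HasDerivWithinAt u₁' (u₁'' t) (Set.Icc (0 : ℝ) 1) t)
    (hu₁'' : ContinuousOn u₁'' (Set.Icc (0 : ℝ) 1))
    (hu₂ : ∀ t ∈ Set.Icc (0 : ℝ) 1, HasDerivWithinAt u₂ (u₂' t) (Set.Icc (0 : ℝ) 1) t)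
    (hu₂' : ∀ t ∈ Set.Icc (0 : ℝ) 1, HasDerivWithinAt u₂' (u₂'' t) (Set.Icc (0 : ℝ) 1) t)
    (hu₂'' : ContinuousOn u₂'' (Set.Icc (0 : ℝ) 1))
    -- bounds for the deterministic part u₁
    (hmse₁ : (1 / (N : ℝ)) * (∑ i, (u₁ (x i)) ^ 2) ≤
      ((M : ℝ) * σ ^ 2 / (N : ℝ)) * F ^ 2 + ((M : ℝ)⁻¹) ^ 4 * ((9 / 8) * β + 1) * F ^ 2)
    (hsec₁ : (∫ t in (0 : ℝ)..1, (u₁'' t) ^ 2) ≤ ((9 / 4) * β + 4) * F ^ 2)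
    -- bounds for the noise part u₂
    (hmse₂ : (1 / (N : ℝ)) * (∑ i, (u₂ (x i)) ^ 2) ≤ 4 * σ ^ 2 * (M : ℝ) / (δ * (N : ℝ)))
    (hsec₂ : (∫ t in (0 : ℝ)..1, (u₂'' t) ^ 2) ≤ 1 / δ)
    -- Sobolev interpolation inequality with constant K* = 32 on I′ for u₁ and u₂
    (hsobolev₁ : ∀ ε : ℝ, 0 < ε → ε ≤ ((q : ℝ) - (p : ℝ)) * (M : ℝ)⁻¹ →
      (∫ t in Set.Ioo ((p : ℝ) * (M : ℝ)⁻¹) ((q : ℝ) * (M : ℝ)⁻¹), (u₁' t) ^ 2) ≤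
        32 * ((ε ^ 2)⁻¹ *
            (∫ t in Set.Ioo ((p : ℝ) * (M : ℝ)⁻¹) ((q : ℝ) * (M : ℝ)⁻¹), (u₁ t) ^ 2)
          + ε ^ 2 *
            ∫ t in Set.Ioo ((p : ℝ) * (M : ℝ)⁻¹) ((q : ℝ) * (M : ℝ)⁻¹), (u₁'' t) ^ 2))
    (hsobolev₂ : ∀ ε : ℝ, 0 < ε → ε ≤ ((q : ℝ) - (p : ℝ)) * (M : ℝ)⁻¹ →
      (∫ t in Set.Ioo ((p : ℝ) * (M : ℝ)⁻¹) ((q : ℝ) * (M : ℝ)⁻¹), (u₂' t) ^ 2) ≤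
        32 * ((ε ^ 2)⁻¹ *
            (∫ t in Set.Ioo ((p : ℝ) * (M : ℝ)⁻¹) ((q : ℝ) * (M : ℝ)⁻¹), (u₂ t) ^ 2)
          + ε ^ 2 *
            ∫ t in Set.Ioo ((p : ℝ) * (M : ℝ)⁻¹) ((q : ℝ) * (M : ℝ)⁻¹), (u₂'' t) ^ 2)) :
    Real.sqrt (∫ t in Set.Ioo ((p : ℝ) * (M : ℝ)⁻¹) ((q : ℝ) * (M : ℝ)⁻¹),
        (u₁ t + u₂ t) ^ 2) ≤
      (2 * F / Real.sqrt γ + 4 / Real.sqrt (δ * γ)) * Real.sqrt ((M : ℝ) * σ ^ 2 / (N : ℝ))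
        + (F * Real.sqrt ((9 * β + 8) / (2 * γ) + 36 * 32 ^ 2 * β + 64 * 32 ^ 2)
            + 4 * 32 / Real.sqrt δ) * ((M : ℝ) ^ 2)⁻¹ := by
  have hM0 : 0 < M := by omega
  have hN0 : 0 < N := by omega
  have hMr : (0 : ℝ) < M := by exact_mod_cast hM0
  have hNr : (0 : ℝ) < N := by exact_mod_cast hN0
  have hab : (p : ℝ) * (M : ℝ)⁻¹ ≤ (q : ℝ) * (M : ℝ)⁻¹ := by gcongr
  have hsub : Set.Icc ((p : ℝ) * (M : ℝ)⁻¹) ((q : ℝ) * (M : ℝ)⁻¹) ⊆ Set.Icc 0 1 := by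
    refine Set.Icc_subset_Icc (by positivity) ?_
    rw [← div_eq_mul_inv, div_le_one hMr]
    exact_mod_cast hqM
  have hA₁ := integral_sq_le_of_interpolation hM0 hN0 hγ hpq.le hqM hgap hlow hu₁
    (fun t ht => (hu₁' t ht).continuousWithinAt) hu₁'' hsobolev₁
  have hA₂ := integral_sq_le_of_interpolation hM0 hN0 hγ hpq.le hqM hgap hlow hu₂
    (fun t ht => (hu₂' t ht).continuousWithinAt) hu₂'' hsobolev₂
  rw [← integral_Ioc_eq_integral_Ioo, ← integral_of_le hab]
  refine (sqrt_integral_sq_add_le hab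
    (fun t ht => (hu₁ t (hsub ht)).continuousWithinAt.mono hsub)
    (fun t ht => (hu₂ t (hsub ht)).continuousWithinAt.mono hsub)).trans ?_
  set h : ℝ := (M : ℝ) * σ ^ 2 / N with hh
  set K : ℝ := (9 * β + 8) / (2 * γ) + 36 * 32 ^ 2 * β + 64 * 32 ^ 2 with hK
  have hh0 : 0 ≤ h := by positivity
  have hK0 : 0 ≤ K := by positivity
  have hdd : ((M : ℝ) ^ 2)⁻¹ = ((M : ℝ)⁻¹) ^ 2 := (inv_pow _ _).symm
  rw [hdd]
  set d : ℝ := (M : ℝ)⁻¹ with hd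
  have hd0 : 0 < d := inv_pos.2 hMr
  have hsqrt_le : ∀ {Q X Y : ℝ}, 0 ≤ X → 0 ≤ Y → Q ≤ X ^ 2 + Y ^ 2 → √Q ≤ X + Y :=
    fun hX hY hQ => Real.sqrt_le_iff.2 ⟨by positivity, by nlinarith [mul_nonneg hX hY]⟩
  have hdet : √(∫ t in ((p : ℝ) * d)..((q : ℝ) * d), (u₁ t) ^ 2)
      ≤ 2 * F / √γ * √h + F * √K * d ^ 2 := by
    refine hsqrt_le (by positivity) (by positivity) ?_
    rw [mul_pow, div_pow, Real.sq_sqrt hγ.le, Real.sq_sqrt hh0, mul_pow _ (d ^ 2),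
      mul_pow F, Real.sq_sqrt hK0]
    have hmse := mul_le_mul_of_nonneg_left hmse₁ (show 0 ≤ 4 / γ by positivity)
    have hsec := mul_le_mul_of_nonneg_left hsec₁ (show 0 ≤ 16 * 32 ^ 2 * d ^ 4 by positivity)
    refine (hA₁.trans (add_le_add hmse hsec)).trans (le_of_eq ?_)
    rw [hK]
    field_simp
    ring
  have hnoise : √(∫ t in ((p : ℝ) * d)..((q : ℝ) * d), (u₂ t) ^ 2)
      ≤ 4 / √(δ * γ) * √h + 4 * 32 / √δ * d ^ 2 := by
    refine hsqrt_le (by positivity) (by positivity) ?_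
    rw [mul_pow, div_pow, Real.sq_sqrt (mul_pos hδ₀ hγ).le, Real.sq_sqrt hh0, mul_pow, div_pow,
      Real.sq_sqrt hδ₀.le]
    have hmse := mul_le_mul_of_nonneg_left hmse₂ (show 0 ≤ 4 / γ by positivity)
    have hsec := mul_le_mul_of_nonneg_left hsec₂ (show 0 ≤ 16 * 32 ^ 2 * d ^ 4 by positivity)
    refine (hA₂.trans (add_le_add hmse hsec)).trans (le_of_eq ?_)
    rw [hh]
    field_simp
    ring
  linarith
end
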